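/- arXiv:1709.03407 — 6 statements merged into one kernel-verified Lean document; each statement's English description precedes it below -/
import Mathlib

section
/- Let $(r_{n,1},\dots,r_{n,n})_{n\ge 1}$ be a triangular array of nonnegative real numbers, let $A_n(x)=\prod_{i=1}^n(x+r_{n,i})=\sum_{k=0}^n a(n,k)x^k$ (so all $a(n,k)\ge 0$), let $p(n,k)=a(n,k)/\sum_{j=0}^n a(n,j)$, $\mu_n=\sum_{i=1}^n \frac{1}{1+r_{n,i}}$ and $\sigma_n^2=\sum_{i=1}^n \frac{r_{n,i}}{(1+r_{n,i})^2}$. If $\sigma_n\to+\infty$ as $n\to\infty$, then the numbers $a(n,k)$ are asymptotically normal by a central limit theorem, i.e. $\lim_{n\to\infty}\sup_{x\in\mathbb{R}}\left|\sum_{k\le \mu_n+x\sigma_n}p(n,k)-\frac{1}{\sqrt{2\pi}}\int_{-\infty}^x e^{-t^2/2}\,dt\right|=0$. -/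
open Filter Finset Polynomial
open scoped Classical

/-- Pointwise convergence of monotone functions to a continuous monotone function is
locally uniform. -/
lemma tendstoLocallyUniformly_of_monotone {F : ℕ → ℝ → ℝ} {G : ℝ → ℝ}
    (hF : ∀ n, Monotone (F n)) (hG : Monotone G) (hGc : Continuous G)
    (h : ∀ x, Tendsto (fun n => F n x) atTop (nhds (G x))) :
    TendstoLocallyUniformly F G atTop := by
  rw [Metric.tendstoLocallyUniformly_iff]
  intro ε hε x
  obtain ⟨δ, hδ, hball⟩ := Metric.continuous_iff.1 hGc x (ε / 4) (by positivity)
  have hu := hball (x - δ / 2) (by rw [Real.dist_eq, abs_lt]; constructor <;> linarith)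
  have hv := hball (x + δ / 2) (by rw [Real.dist_eq, abs_lt]; constructor <;> linarith)
  rw [Real.dist_eq, abs_lt] at hu hv
  refine ⟨Set.Icc (x - δ / 2) (x + δ / 2),
    Icc_mem_nhds (by linarith) (by linarith), ?_⟩
  filter_upwards [Metric.tendsto_nhds.1 (h (x - δ / 2)) (ε / 4) (by positivity),
    Metric.tendsto_nhds.1 (h (x + δ / 2)) (ε / 4) (by positivity)] with n hnu hnv y hy
  rw [Real.dist_eq, abs_lt] at *
  have h1 := hF n hy.1
  have h2 := hF n hy.2
  have h3 := hG hy.1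
  have h4 := hG hy.2
  constructor <;> linarith

/-- **Pólya's theorem**: pointwise convergence of distribution functions to a continuous
distribution function is uniform. -/
lemma tendstoUniformly_of_monotone {F : ℕ → ℝ → ℝ} {G : ℝ → ℝ}
    (hF : ∀ n, Monotone (F n)) (hF0 : ∀ n x, 0 ≤ F n x) (hF1 : ∀ n x, F n x ≤ 1)
    (hG : Monotone G) (hGc : Continuous G)
    (hG0 : Tendsto G atBot (nhds 0)) (hG1 : Tendsto G atTop (nhds 1))
    (h : ∀ x, Tendsto (fun n => F n x) atTop (nhds (G x))) :
    TendstoUniformly F G atTop := by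
  rw [Metric.tendstoUniformly_iff]
  intro ε hε
  obtain ⟨a, ha⟩ := (Metric.tendsto_nhds.1 hG0 (ε / 4) (by positivity)).exists
  obtain ⟨b, hb⟩ := (Metric.tendsto_nhds.1 hG1 (ε / 4) (by positivity)).exists
  have hloc := (tendstoLocallyUniformlyOn_iff_tendstoUniformlyOn_of_compact
    (isCompact_Icc (a := a) (b := b))).1
    (tendstoLocallyUniformly_of_monotone hF hG hGc h).tendstoLocallyUniformlyOn
  filter_upwards [Metric.tendstoUniformlyOn_iff.1 hloc ε hε,
    Metric.tendsto_nhds.1 (h a) (ε / 4) (by positivity),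
    Metric.tendsto_nhds.1 (h b) (ε / 4) (by positivity)] with n hn hna hnb x
  have hGx0 : 0 ≤ G x := hG.le_of_tendsto hG0 x
  have hGx1 : G x ≤ 1 := hG.ge_of_tendsto hG1 x
  have hFx0 := hF0 n x
  have hFx1 := hF1 n x
  rcases lt_or_ge x a with hxa | hxa
  · have h1 := hF n hxa.le
    have h2 := hG hxa.le
    rw [Real.dist_eq, abs_lt] at *
    constructor <;> linarith
  rcases lt_or_ge b x with hxb | hxb
  · have h1 := hF n hxb.le
    have h2 := hG hxb.le
    rw [Real.dist_eq, abs_lt] at *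
    constructor <;> linarith
  · exact hn x ⟨hxa, hxb⟩

lemma continuous_cdf_of_measure_singleton (ν : MeasureTheory.Measure ℝ)
    [MeasureTheory.IsProbabilityMeasure ν] (hν : ∀ x, ν {x} = 0) :
    Continuous (ProbabilityTheory.cdf ν) := by
  rw [continuous_iff_continuousAt]
  intro x
  have h := hν x
  rw [← ProbabilityTheory.measure_cdf ν, StieltjesFunction.measure_singleton,
    ENNReal.ofReal_eq_zero] at h
  rw [(ProbabilityTheory.cdf ν).mono.continuousAt_iff_leftLim_eq_rightLim,
    StieltjesFunction.rightLim_eq]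
  exact le_antisymm ((ProbabilityTheory.cdf ν).mono.leftLim_le le_rfl) (by linarith)

lemma cdf_gaussianReal_zero_one (x : ℝ) :
    ProbabilityTheory.cdf (ProbabilityTheory.gaussianReal 0 1) x
      = (Real.sqrt (2 * Real.pi))⁻¹ * ∫ t in Set.Iic x, Real.exp (-t ^ 2 / 2) := by
  rw [ProbabilityTheory.cdf_eq_real, MeasureTheory.measureReal_def,
    ProbabilityTheory.gaussianReal_apply_eq_integral _ one_ne_zero, ENNReal.toReal_ofReal
    (MeasureTheory.integral_nonneg fun t => ProbabilityTheory.gaussianPDFReal_nonneg _ _ _),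
    ← MeasureTheory.integral_const_mul]
  simp [ProbabilityTheory.gaussianPDFReal]

lemma tendstoUniformly_cdf_of_tendsto_charFun {ν : ℕ → MeasureTheory.Measure ℝ}
    [∀ n, MeasureTheory.IsProbabilityMeasure (ν n)] {ν₀ : MeasureTheory.Measure ℝ}
    [MeasureTheory.IsProbabilityMeasure ν₀] (hν₀ : ∀ x, ν₀ {x} = 0)
    (h : ∀ t, Tendsto (fun n => MeasureTheory.charFun (ν n) t) atTop
      (nhds (MeasureTheory.charFun ν₀ t))) :
    TendstoUniformly (fun n x => ProbabilityTheory.cdf (ν n) x) (ProbabilityTheory.cdf ν₀)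
      atTop := by
  refine tendstoUniformly_of_monotone (fun n => ProbabilityTheory.monotone_cdf _)
    (fun n => ProbabilityTheory.cdf_nonneg _) (fun n => ProbabilityTheory.cdf_le_one _)
    (ProbabilityTheory.monotone_cdf _) (continuous_cdf_of_measure_singleton ν₀ hν₀)
    (ProbabilityTheory.tendsto_cdf_atBot _) (ProbabilityTheory.tendsto_cdf_atTop _) fun x => ?_
  let P : ℕ → MeasureTheory.ProbabilityMeasure ℝ := fun n => ⟨ν n, inferInstance⟩
  let P₀ : MeasureTheory.ProbabilityMeasure ℝ := ⟨ν₀, inferInstance⟩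
  have hP : Tendsto P atTop (nhds P₀) :=
    MeasureTheory.ProbabilityMeasure.tendsto_of_tendsto_charFun h
  have key := MeasureTheory.ProbabilityMeasure.tendsto_measure_of_null_frontier_of_tendsto' hP
    (E := Set.Iic x) (by simpa [P₀] using hν₀ x)
  have := (ENNReal.tendsto_toReal (MeasureTheory.measure_ne_top _ _)).comp key
  simpa [ProbabilityTheory.cdf_eq_real, MeasureTheory.measureReal_def, Function.comp_def, P, P₀]
    using this

lemma norm_exp_sub_quadratic_le {z : ℂ} (hz : ‖z‖ ≤ 1) :
    ‖Complex.exp z - (1 + z + z ^ 2 / 2)‖ ≤ ‖z‖ ^ 3 := by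
  have h := Complex.exp_bound hz (n := 3) (by norm_num)
  rw [show ∑ m ∈ range 3, z ^ m / (m.factorial : ℂ) = 1 + z + z ^ 2 / 2 by
    simp [Finset.sum_range_succ, Nat.factorial]] at h
  refine h.trans (mul_le_of_le_one_right (by positivity) ?_)
  norm_num [Nat.factorial]

/-- The characteristic function of a centred Bernoulli variable is close to that of the Gaussian
of the same variance. -/
lemma norm_bernoulli_charFun_sub_le {p q s : ℝ} (hp : 0 ≤ p) (hq : 0 ≤ q) (hpq : p + q = 1)
    (hs : |s| ≤ 1) :
    ‖((p : ℂ) * Complex.exp ((s * q : ℝ) * Complex.I)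
        + q * Complex.exp ((-(s * p) : ℝ) * Complex.I))
      - Complex.exp ((-(p * q * s ^ 2 / 2) : ℝ))‖ ≤ p * q * (2 * |s| ^ 3) := by
  have hp1 : p ≤ 1 := by linarith
  have hq1 : q ≤ 1 := by linarith
  have hs0 := abs_nonneg s
  have hss : s ^ 2 = |s| ^ 2 := (sq_abs s).symm
  have hs2 : |s| ^ 2 ≤ 1 := pow_le_one₀ hs0 hs
  have hpq0 : 0 ≤ p * q := mul_nonneg hp hq
  have hpq1 : p * q ≤ 1 := mul_le_one₀ hp1 hq hq1
  have n1 : ‖((s * q : ℝ) : ℂ) * Complex.I‖ = |s| * q := by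
    rw [norm_mul, Complex.norm_I, mul_one, Complex.norm_real, Real.norm_eq_abs, abs_mul,
      abs_of_nonneg hq]
  have n2 : ‖((-(s * p) : ℝ) : ℂ) * Complex.I‖ = |s| * p := by
    rw [norm_mul, Complex.norm_I, mul_one, Complex.norm_real, Real.norm_eq_abs, abs_neg, abs_mul,
      abs_of_nonneg hp]
  have n3 : ‖((-(p * q * s ^ 2 / 2) : ℝ) : ℂ)‖ = p * q * |s| ^ 2 / 2 := by
    rw [Complex.norm_real, Real.norm_eq_abs, abs_neg, hss, abs_of_nonneg (by positivity)]
  have e1 := norm_exp_sub_quadratic_le (z := ((s * q : ℝ) : ℂ) * Complex.I)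
    (by rw [n1]; exact mul_le_one₀ hs hq hq1)
  have e2 := norm_exp_sub_quadratic_le (z := ((-(s * p) : ℝ) : ℂ) * Complex.I)
    (by rw [n2]; exact mul_le_one₀ hs hp hp1)
  have e3 := Complex.norm_exp_sub_one_sub_id_le (x := ((-(p * q * s ^ 2 / 2) : ℝ) : ℂ))
    (by rw [n3]; nlinarith [mul_le_one₀ hpq1 (sq_nonneg |s|) hs2])
  rw [n1] at e1
  rw [n2] at e2
  rw [n3] at e3
  set E1 := Complex.exp (((s * q : ℝ) : ℂ) * Complex.I)
  set E2 := Complex.exp (((-(s * p) : ℝ) : ℂ) * Complex.I)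
  set E3 := Complex.exp ((-(p * q * s ^ 2 / 2) : ℝ))
  have hpc : (p : ℂ) = 1 - q := by rw [eq_sub_iff_add_eq]; exact_mod_cast hpq
  have split : (p * E1 + q * E2) - E3
      = p * (E1 - (1 + ((s * q : ℝ) : ℂ) * Complex.I + (((s * q : ℝ) : ℂ) * Complex.I) ^ 2 / 2))
      + q * (E2 - (1 + ((-(s * p) : ℝ) : ℂ) * Complex.I
          + (((-(s * p) : ℝ) : ℂ) * Complex.I) ^ 2 / 2))
      - (E3 - 1 - ((-(p * q * s ^ 2 / 2) : ℝ) : ℂ)) := by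
    simp only [mul_pow, Complex.I_sq]
    push_cast
    rw [hpc]
    ring
  rw [split]
  refine (norm_sub_le _ _).trans ((add_le_add (norm_add_le _ _) e3).trans ?_)
  rw [norm_mul, norm_mul, Complex.norm_real, Complex.norm_real, Real.norm_of_nonneg hp,
    Real.norm_of_nonneg hq]
  have b1 : p * (|s| * q) ^ 3 + q * (|s| * p) ^ 3 = p * q * |s| ^ 3 * (p ^ 2 + q ^ 2) := by ring
  have b2 : p ^ 2 + q ^ 2 + p * q / 4 ≤ 1 := by nlinarith
  have b3 : (p * q * |s| ^ 2 / 2) ^ 2 ≤ p * q * |s| ^ 3 * (p * q / 4) := by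
    have : |s| ^ 3 * |s| ≤ |s| ^ 3 := mul_le_of_le_one_right (by positivity) hs
    nlinarith [mul_le_mul_of_nonneg_left this (mul_nonneg hpq0 hpq0)]
  have b4 : 0 ≤ p * q * |s| ^ 3 := by positivity
  nlinarith [mul_le_mul_of_nonneg_left e1 hp, mul_le_mul_of_nonneg_left e2 hq,
    mul_le_mul_of_nonneg_left b2 b4]

lemma norm_bernoulli_charFun_le_one {p q : ℝ} (hp : 0 ≤ p) (hq : 0 ≤ q) (hpq : p + q = 1)
    (x y : ℝ) :
    ‖(p : ℂ) * Complex.exp (x * Complex.I) + q * Complex.exp (y * Complex.I)‖ ≤ 1 := by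
  refine (norm_add_le _ _).trans ?_
  rw [norm_mul, norm_mul, Complex.norm_exp_ofReal_mul_I, Complex.norm_exp_ofReal_mul_I,
    Complex.norm_real, Complex.norm_real, Real.norm_of_nonneg hp, Real.norm_of_nonneg hq]
  linarith

lemma norm_prod_sub_prod_le_sum {ι : Type*} (s : Finset ι) (f g : ι → ℂ)
    (hf : ∀ i ∈ s, ‖f i‖ ≤ 1) (hg : ∀ i ∈ s, ‖g i‖ ≤ 1) :
    ‖∏ i ∈ s, f i - ∏ i ∈ s, g i‖ ≤ ∑ i ∈ s, ‖f i - g i‖ := by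
  induction s using Finset.induction_on with
  | empty => simp
  | insert j s hj ih =>
    rw [Finset.prod_insert hj, Finset.prod_insert hj, Finset.sum_insert hj]
    have ih' := ih (fun i hi => hf i (Finset.mem_insert_of_mem hi))
      (fun i hi => hg i (Finset.mem_insert_of_mem hi))
    have h1 : ‖∏ i ∈ s, f i‖ ≤ 1 := by
      rw [norm_prod]
      exact Finset.prod_le_one (fun _ _ => norm_nonneg _)
        fun i hi => hf i (Finset.mem_insert_of_mem hi)
    have h2 := hg j (Finset.mem_insert_self j s)
    calc ‖f j * ∏ i ∈ s, f i - g j * ∏ i ∈ s, g i‖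
        = ‖(f j - g j) * ∏ i ∈ s, f i + g j * (∏ i ∈ s, f i - ∏ i ∈ s, g i)‖ := by ring_nf
      _ ≤ ‖f j - g j‖ * ‖∏ i ∈ s, f i‖ + ‖g j‖ * ‖∏ i ∈ s, f i - ∏ i ∈ s, g i‖ := by
        refine (norm_add_le _ _).trans_eq ?_
        rw [norm_mul, norm_mul]
      _ ≤ ‖f j - g j‖ + ∑ i ∈ s, ‖f i - g i‖ :=
        add_le_add (mul_le_of_le_one_right (norm_nonneg _) h1)
          ((mul_le_of_le_one_left (norm_nonneg _) h2).trans ih')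

/-- The law on `ℝ` giving mass `w k` to the point `x k`, for `k < N`. -/
noncomputable def discreteLaw (N : ℕ) (w x : ℕ → ℝ) : MeasureTheory.Measure ℝ :=
  ∑ k ∈ range N, ENNReal.ofReal (w k) • MeasureTheory.Measure.dirac (x k)

lemma discreteLaw_isProbabilityMeasure {N : ℕ} {w : ℕ → ℝ} (hw : ∀ k, 0 ≤ w k)
    (hw1 : ∑ k ∈ range N, w k = 1) (x : ℕ → ℝ) :
    MeasureTheory.IsProbabilityMeasure (discreteLaw N w x) := by
  constructor
  simp [discreteLaw, ← ENNReal.ofReal_sum_of_nonneg fun k _ => hw k, hw1]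

lemma discreteLaw_real_Iic {N : ℕ} {w : ℕ → ℝ} (hw : ∀ k, 0 ≤ w k) (x : ℕ → ℝ) (y : ℝ) :
    (discreteLaw N w x).real (Set.Iic y) = ∑ k ∈ range N, if x k ≤ y then w k else 0 := by
  rw [MeasureTheory.measureReal_def, discreteLaw, MeasureTheory.Measure.finsetSum_apply,
    ENNReal.toReal_sum]
  · refine Finset.sum_congr rfl fun k _ => ?_
    by_cases h : x k ≤ y <;> simp [Set.indicator, h, hw k]
  · intro k _
    rw [MeasureTheory.Measure.smul_apply, smul_eq_mul]
    exact ENNReal.mul_ne_top ENNReal.ofReal_ne_top (MeasureTheory.measure_ne_top _ _)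

lemma charFun_discreteLaw {N : ℕ} {w : ℕ → ℝ} (hw : ∀ k, 0 ≤ w k) (x : ℕ → ℝ) (t : ℝ) :
    MeasureTheory.charFun (discreteLaw N w x) t
      = ∑ k ∈ range N, (w k : ℂ) * Complex.exp ((t * x k : ℝ) * Complex.I) := by
  rw [MeasureTheory.charFun_apply_real, discreteLaw, MeasureTheory.integral_finsetSum_measure]
  · refine Finset.sum_congr rfl fun k _ => ?_
    rw [MeasureTheory.integral_smul_measure, MeasureTheory.integral_dirac,
      ENNReal.toReal_ofReal (hw k)]
    simp
  · intro k _
    refine MeasureTheory.Integrable.smul_measure ?_ ENNReal.ofReal_ne_top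
    exact MeasureTheory.integrable_dirac enorm_lt_top

lemma coeff_prod_X_add_C_nonneg {ι : Type*} (s : Finset ι) {r : ι → ℝ} (hr : ∀ i, 0 ≤ r i)
    (k : ℕ) : 0 ≤ (∏ i ∈ s, (X + C (r i))).coeff k := by
  induction s using Finset.induction_on generalizing k with
  | empty =>
    rw [Finset.prod_empty, coeff_one]
    split_ifs <;> norm_num
  | insert j s hj ih =>
    rw [Finset.prod_insert hj, coeff_mul]
    refine Finset.sum_nonneg fun c _ => mul_nonneg ?_ (ih _)
    rw [coeff_add, coeff_X, coeff_C]
    exact add_nonneg (by split_ifs <;> norm_num) (by split_ifs <;> [exact hr j; exact le_rfl])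

lemma sum_coeff_prod_X_add_C_mul_pow {n : ℕ} (r : Fin n → ℝ) (z : ℂ) :
    ∑ k ∈ range (n + 1), (((∏ i : Fin n, (X + C (r i))).coeff k : ℝ) : ℂ) * z ^ k
      = ∏ i : Fin n, (z + r i) := by
  have hd : (∏ i : Fin n, (X + C (r i))).natDegree < n + 1 := by
    rw [natDegree_prod_of_monic _ _ fun i _ => monic_X_add_C _]
    simp
  have h := eval₂_eq_sum_range' Complex.ofRealHom hd z
  rw [eval₂_finsetProd] at h
  simpa using h.symm

/-- The characteristic function of the standardised law with weights proportional to the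
coefficients of `∏ (X + r i)` factors over the roots. -/
lemma charFun_coeff_law_eq_prod {n : ℕ} {r : Fin n → ℝ} (hr : ∀ i, 0 ≤ r i) {a : ℕ → ℝ}
    (ha : ∀ k, a k = (∏ i : Fin n, (X + C (r i))).coeff k) {S : ℝ}
    (hS : S = ∏ i : Fin n, (1 + r i)) {m : ℝ} (hm : m = ∑ i : Fin n, 1 / (1 + r i)) (s : ℝ) :
    ∑ k ∈ range (n + 1), ((a k / S : ℝ) : ℂ) * Complex.exp ((s * (k - m) : ℝ) * Complex.I)
      = ∏ i : Fin n, (((1 / (1 + r i) : ℝ) : ℂ)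
            * Complex.exp ((s * (r i / (1 + r i)) : ℝ) * Complex.I)
          + ((r i / (1 + r i) : ℝ) : ℂ)
            * Complex.exp ((-(s * (1 / (1 + r i))) : ℝ) * Complex.I)) := by
  have hfac : ∀ i : Fin n, (((1 / (1 + r i) : ℝ) : ℂ)
            * Complex.exp ((s * (r i / (1 + r i)) : ℝ) * Complex.I)
          + ((r i / (1 + r i) : ℝ) : ℂ)
            * Complex.exp ((-(s * (1 / (1 + r i))) : ℝ) * Complex.I))
      = (((1 + r i : ℝ) : ℂ))⁻¹ * (Complex.exp ((-(s * (1 / (1 + r i))) : ℝ) * Complex.I)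
        * (Complex.exp (s * Complex.I) + r i)) := by
    intro i
    have h1 : 1 + r i ≠ 0 := by have := hr i; positivity
    have e : ((s * (r i / (1 + r i)) : ℝ) : ℂ) * Complex.I
        = ((-(s * (1 / (1 + r i))) : ℝ) : ℂ) * Complex.I + s * Complex.I := by
      rw [show s * (r i / (1 + r i)) = -(s * (1 / (1 + r i))) + s by field_simp; ring]
      push_cast
      ring
    rw [e, Complex.exp_add]
    push_cast
    ring
  rw [Finset.prod_congr rfl fun i _ => hfac i, Finset.prod_mul_distrib, Finset.prod_mul_distrib,
    ← sum_coeff_prod_X_add_C_mul_pow, ← Complex.exp_sum, Finset.mul_sum, Finset.mul_sum]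
  refine Finset.sum_congr rfl fun k _ => ?_
  have e1 : ∑ i : Fin n, ((-(s * (1 / (1 + r i))) : ℝ) : ℂ) * Complex.I
      = ((-(s * m) : ℝ) : ℂ) * Complex.I := by
    rw [← Finset.sum_mul, ← Complex.ofReal_sum, hm, Finset.mul_sum, Finset.sum_neg_distrib]
  have e2 : ((s * (k - m) : ℝ) : ℂ) * Complex.I
      = ((-(s * m) : ℝ) : ℂ) * Complex.I + k * (s * Complex.I) := by
    push_cast
    ring
  rw [e1, e2, Complex.exp_add, Complex.exp_nat_mul, ha k, hS, Finset.prod_inv_distrib]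
  push_cast
  ring

lemma norm_coeff_law_charFun_sub_le {n : ℕ} {r : Fin n → ℝ} (hr : ∀ i, 0 ≤ r i) {v : ℝ}
    (hv : v = ∑ i : Fin n, r i / (1 + r i) ^ 2) {s : ℝ} (hs : |s| ≤ 1) :
    ‖∏ i : Fin n, (((1 / (1 + r i) : ℝ) : ℂ)
            * Complex.exp ((s * (r i / (1 + r i)) : ℝ) * Complex.I)
          + ((r i / (1 + r i) : ℝ) : ℂ)
            * Complex.exp ((-(s * (1 / (1 + r i))) : ℝ) * Complex.I))
      - Complex.exp ((-(v * s ^ 2 / 2) : ℝ))‖ ≤ v * (2 * |s| ^ 3) := by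
  have hpos : ∀ i, 0 < 1 + r i := fun i => by have := hr i; positivity
  have hsum : ∀ i, 1 / (1 + r i) + r i / (1 + r i) = 1 := fun i => by
    rw [← add_div, div_self (hpos i).ne']
  have hp : ∀ i, 0 ≤ 1 / (1 + r i) := fun i => by have := hpos i; positivity
  have hq : ∀ i, 0 ≤ r i / (1 + r i) := fun i => div_nonneg (hr i) (hpos i).le
  have hv' : v = ∑ i : Fin n, 1 / (1 + r i) * (r i / (1 + r i)) := by
    rw [hv]
    refine Finset.sum_congr rfl fun i _ => ?_
    rw [div_mul_div_comm, one_mul, sq]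
  have hexp : Complex.exp ((-(v * s ^ 2 / 2) : ℝ))
      = ∏ i : Fin n,
        Complex.exp ((-(1 / (1 + r i) * (r i / (1 + r i)) * s ^ 2 / 2) : ℝ)) := by
    rw [← Complex.exp_sum, ← Complex.ofReal_sum, Finset.sum_neg_distrib, ← Finset.sum_div,
      ← Finset.sum_mul, ← hv']
  rw [hexp]
  refine (norm_prod_sub_prod_le_sum _ _ _
    (fun i _ => norm_bernoulli_charFun_le_one (hp i) (hq i) (hsum i) _ _) fun i _ => ?_).trans ?_
  · rw [Complex.norm_exp_ofReal, Real.exp_le_one_iff]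
    have := mul_nonneg (mul_nonneg (hp i) (hq i)) (sq_nonneg s)
    linarith
  · rw [hv', Finset.sum_mul]
    exact Finset.sum_le_sum fun i _ =>
      norm_bernoulli_charFun_sub_le (hp i) (hq i) (hsum i) hs

/-- Harper's criterion, central limit theorem part. -/
theorem laplacian_clt_criterion
    (r : (n : ℕ) → Fin n → ℝ) (hr : ∀ n i, 0 ≤ r n i)
    (a : ℕ → ℕ → ℝ)
    (ha : ∀ n k, a n k = (∏ i : Fin n, (X + C (r n i))).coeff k)
    (μ σ : ℕ → ℝ)
    (hμ : ∀ n, μ n = ∑ i : Fin n, 1 / (1 + r n i))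
    (hσ : ∀ n, σ n ^ 2 = ∑ i : Fin n, r n i / (1 + r n i) ^ 2)
    (hσ0 : ∀ n, 0 ≤ σ n)
    (hσtop : Tendsto σ atTop atTop) :
    Tendsto (fun n : ℕ => ⨆ x : ℝ,
      |(∑ k ∈ Finset.range (n + 1),
          if (k : ℝ) ≤ μ n + x * σ n then a n k / (∑ j ∈ Finset.range (n + 1), a n j) else 0)
        - (Real.sqrt (2 * Real.pi))⁻¹ * ∫ t in Set.Iic x, Real.exp (-t ^ 2 / 2)|)
      atTop (nhds 0) := by
  have hS : ∀ n, ∑ j ∈ Finset.range (n + 1), a n j = ∏ i : Fin n, (1 + r n i) := fun n => by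
    have h := sum_coeff_prod_X_add_C_mul_pow (r n) 1
    simp_rw [← ha n, one_pow, mul_one] at h
    exact_mod_cast h
  have hSpos : ∀ n, 0 < ∏ i : Fin n, (1 + r n i) := fun n =>
    Finset.prod_pos fun i _ => by have := hr n i; positivity
  have hw : ∀ n k, 0 ≤ a n k / (∑ j ∈ Finset.range (n + 1), a n j) := fun n k => by
    rw [hS, ha]
    exact div_nonneg (coeff_prod_X_add_C_nonneg _ (hr n) k) (hSpos n).le
  let ν : ℕ → MeasureTheory.Measure ℝ := fun n => discreteLaw (n + 1)
    (fun k => a n k / (∑ j ∈ Finset.range (n + 1), a n j)) (fun k => (k - μ n) / σ n)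
  have : ∀ n, MeasureTheory.IsProbabilityMeasure (ν n) := fun n =>
    discreteLaw_isProbabilityMeasure (hw n)
      (by rw [← Finset.sum_div, hS, div_self (hSpos n).ne']) _
  have hcf : ∀ t, Tendsto (fun n => MeasureTheory.charFun (ν n) t) atTop
      (nhds (MeasureTheory.charFun (ProbabilityTheory.gaussianReal 0 1) t)) := by
    intro t
    rw [tendsto_iff_norm_sub_tendsto_zero]
    have hlim : Tendsto (fun n => 2 * |t| ^ 3 / σ n) atTop (nhds 0) :=
      hσtop.const_div_atTop _
    refine squeeze_zero' (Eventually.of_forall fun _ => norm_nonneg _) ?_ hlim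
    filter_upwards [hσtop.eventually_gt_atTop 0, hσtop.eventually_ge_atTop |t|] with n hn hnt
    have hs : |t / σ n| ≤ 1 := by
      rw [abs_div, abs_of_pos hn]
      exact div_le_one_of_le₀ hnt hn.le
    have key := norm_coeff_law_charFun_sub_le (hr n) (hσ n) hs
    rw [← charFun_coeff_law_eq_prod (hr n) (ha n) (hS n) (hμ n)] at key
    have e1 : MeasureTheory.charFun (ν n) t = ∑ k ∈ range (n + 1),
        ((a n k / (∑ j ∈ Finset.range (n + 1), a n j) : ℝ) : ℂ)
          * Complex.exp ((t / σ n * (k - μ n) : ℝ) * Complex.I) := by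
      rw [charFun_discreteLaw (hw n)]
      refine Finset.sum_congr rfl fun k _ => ?_
      rw [mul_div_assoc', mul_div_right_comm]
    have e2 : MeasureTheory.charFun (ProbabilityTheory.gaussianReal 0 1) t
        = Complex.exp ((-(σ n ^ 2 * (t / σ n) ^ 2 / 2) : ℝ)) := by
      rw [ProbabilityTheory.charFun_gaussianReal, ← mul_pow, mul_div_cancel₀ _ hn.ne']
      push_cast
      congr 1
      simp
    rw [e1, e2]
    refine key.trans_eq ?_
    rw [abs_div, abs_of_pos hn]
    field_simp
  have := ProbabilityTheory.nullSingletonClass_gaussianReal (μ := 0) one_ne_zero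
  have hunif := tendstoUniformly_cdf_of_tendsto_charFun (fun x => MeasureTheory.measure_singleton x) hcf
  rw [Metric.tendstoUniformly_iff] at hunif
  rw [Metric.tendsto_nhds]
  intro ε hε
  filter_upwards [hunif (ε / 2) (by positivity), hσtop.eventually_gt_atTop 0] with n hn hσn
  rw [Real.dist_0_eq_abs, abs_of_nonneg (Real.iSup_nonneg fun _ => abs_nonneg _)]
  refine lt_of_le_of_lt (Real.iSup_le (fun x => ?_) (by positivity)) (half_lt_self hε)
  have h := hn x
  rw [Real.dist_eq, abs_sub_comm, cdf_gaussianReal_zero_one, ProbabilityTheory.cdf_eq_real,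
    discreteLaw_real_Iic (hw n)] at h
  refine le_trans (le_of_eq ?_) h.le
  congr 2
  refine Finset.sum_congr rfl fun k _ => ?_
  have hiff : (k : ℝ) ≤ μ n + x * σ n ↔ (k - μ n) / σ n ≤ x := by
    rw [div_le_iff₀ hσn, sub_le_iff_le_add']
  simp only [hiff]
end

section
/- Let $(r_{n,1},\dots,r_{n,n})_{n\ge 1}$ be a triangular array of nonnegative real numbers, let $A_n(x)=\prod_{i=1}^n(x+r_{n,i})=\sum_{k=0}^n a(n,k)x^k$ (so all $a(n,k)\ge 0$), let $p(n,k)=a(n,k)/\sum_{j=0}^n a(n,j)$, $\mu_n=\sum_{i=1}^n \frac{1}{1+r_{n,i}}$ and $\sigma_n^2=\sum_{i=1}^n \frac{r_{n,i}}{(1+r_{n,i})^2}$. If $\sigma_n\to+\infty$ as $n\to\infty$, then the numbers $a(n,k)$ are asymptotically normal by a local limit theorem on $\mathbb{R}$, i.e. $\lim_{n\to\infty}\sup_{x\in\mathbb{R}}\left|\sigma_n\, p(n,\lfloor \mu_n+x\sigma_n\rfloor)-\frac{1}{\sqrt{2\pi}}e^{-x^2/2}\right|=0$. -/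
open Filter Finset Polynomial
open scoped Classical

/-- The characteristic function of a centred Bernoulli variable with success probability
`1 / (1 + r)`. -/
noncomputable def centeredBernoulliCharFun (r t : ℝ) : ℂ :=
  (Complex.exp (t * Complex.I) + r) / (1 + r) * Complex.exp (-(t / (1 + r) : ℝ) * Complex.I)

lemma continuous_centeredBernoulliCharFun (r : ℝ) : Continuous (centeredBernoulliCharFun r) := by
  unfold centeredBernoulliCharFun
  fun_prop

lemma norm_centeredBernoulliCharFun_le {r t : ℝ} (hr : 0 ≤ r) (ht : |t| ≤ Real.pi) :
    ‖centeredBernoulliCharFun r t‖ ≤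
      Real.exp (-(2 / Real.pi ^ 2 * t ^ 2) * (r / (1 + r) ^ 2)) := by
  have hr1 : (0 : ℝ) < 1 + r := by linarith
  have h1 : ‖centeredBernoulliCharFun r t‖ = ‖Complex.exp (t * Complex.I) + r‖ / (1 + r) := by
    unfold centeredBernoulliCharFun
    rw [norm_mul, ← Complex.ofReal_neg, Complex.norm_exp_ofReal_mul_I, mul_one, norm_div]
    congr 1
    rw [← Complex.ofReal_one, ← Complex.ofReal_add, Complex.norm_real, Real.norm_of_nonneg hr1.le]
  have h2 : ‖Complex.exp (t * Complex.I) + r‖ ^ 2 = (1 + r) ^ 2 - 2 * r * (1 - Real.cos t) := by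
    rw [Complex.sq_norm, Complex.normSq_apply]
    simp only [Complex.add_re, Complex.add_im, Complex.exp_ofReal_mul_I_re,
      Complex.exp_ofReal_mul_I_im, Complex.ofReal_re, Complex.ofReal_im]
    nlinarith [Real.sin_sq_add_cos_sq t]
  have hcos := Real.cos_le_one_sub_mul_cos_sq ht
  rw [h1]
  refine le_of_sq_le_sq ?_ (Real.exp_pos _).le
  rw [div_pow, h2, ← Real.exp_nat_mul]
  have hv : 0 ≤ r / (1 + r) ^ 2 := by positivity
  calc ((1 + r) ^ 2 - 2 * r * (1 - Real.cos t)) / (1 + r) ^ 2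
      = 1 - 2 * (r / (1 + r) ^ 2) * (1 - Real.cos t) := by field_simp
    _ ≤ 1 - 2 * (r / (1 + r) ^ 2) * (2 / Real.pi ^ 2 * t ^ 2) := by
        gcongr; linarith
    _ = (2 : ℕ) * (-(2 / Real.pi ^ 2 * t ^ 2) * (r / (1 + r) ^ 2)) + 1 := by push_cast; ring
    _ ≤ _ := Real.add_one_le_exp _

lemma norm_exp_mul_I_sub_quadratic_le {x : ℝ} (hx : |x| ≤ 1) :
    ‖Complex.exp (x * Complex.I) - (1 + x * Complex.I - x ^ 2 / 2)‖ ≤ 3 * |x| ^ 3 := by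
  have h := Complex.norm_exp_sub_sum_le_norm_mul_exp (x * Complex.I) 3
  have hn : ‖(x : ℂ) * Complex.I‖ = |x| := by simp
  rw [hn] at h
  have he : Real.exp |x| ≤ 3 :=
    (Real.exp_le_exp.2 hx).trans (by linarith [Real.exp_one_lt_d9])
  have hs : ∑ m ∈ Finset.range 3, ((x : ℂ) * Complex.I) ^ m / (m.factorial : ℂ) =
      1 + x * Complex.I - x ^ 2 / 2 := by
    simp [Finset.sum_range_succ, Nat.factorial, mul_pow]
    ring
  rw [hs] at h
  calc _ ≤ |x| ^ 3 * Real.exp |x| := h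
    _ ≤ |x| ^ 3 * 3 := by gcongr
    _ = _ := mul_comm _ _

lemma norm_centeredBernoulliCharFun_sub_exp_le {r t : ℝ} (hr : 0 ≤ r) (ht : |t| ≤ 1) :
    ‖centeredBernoulliCharFun r t - (Real.exp (-(r / (1 + r) ^ 2) * t ^ 2 / 2) : ℝ)‖ ≤
      7 * (r / (1 + r) ^ 2) * |t| ^ 3 := by
  have hr1 : (0 : ℝ) < 1 + r := by linarith
  obtain ⟨p, hp⟩ : ∃ p, p = 1 / (1 + r) := ⟨_, rfl⟩
  obtain ⟨q, hq⟩ : ∃ q, q = r / (1 + r) := ⟨_, rfl⟩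
  have hp0 : 0 ≤ p := by rw [hp]; positivity
  have hq0 : 0 ≤ q := by rw [hq]; positivity
  have hpq : p + q = 1 := by rw [hp, hq]; field_simp
  have hv : r / (1 + r) ^ 2 = p * q := by rw [hp, hq]; field_simp
  have hp1 : p ≤ 1 := by linarith
  have hq1 : q ≤ 1 := by linarith
  have hform : centeredBernoulliCharFun r t =
      p * Complex.exp ((q * t : ℝ) * Complex.I) + q * Complex.exp ((-(p * t) : ℝ) * Complex.I) := by
    have hdiv : (Complex.exp (t * Complex.I) + r) / (1 + r) =
        p * Complex.exp (t * Complex.I) + q := by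
      rw [hp, hq]; push_cast; ring
    have hexp : Complex.exp ((q * t : ℝ) * Complex.I) =
        Complex.exp (t * Complex.I) * Complex.exp ((-(p * t) : ℝ) * Complex.I) := by
      rw [← Complex.exp_add]
      congr 1
      have : q = 1 - p := by linarith
      rw [this]; push_cast; ring
    have ht' : t / (1 + r) = p * t := by rw [hp]; ring
    rw [centeredBernoulliCharFun, hdiv, hexp, ht']
    push_cast; ring
  have bound_sq : ∀ s : ℝ, 0 ≤ s → s ≤ 1 → 3 * |s * t| ^ 3 ≤ 3 * s * |t| ^ 3 := by
    intro s hs0 hs1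
    rw [abs_mul, abs_of_nonneg hs0, mul_pow]
    have : s ^ 3 ≤ s := pow_le_of_le_one hs0 hs1 (by norm_num)
    have h3 : 0 ≤ |t| ^ 3 := by positivity
    nlinarith
  have abs_le : ∀ s : ℝ, 0 ≤ s → s ≤ 1 → |s * t| ≤ 1 := by
    intro s hs0 hs1
    rw [abs_mul, abs_of_nonneg hs0]
    exact mul_le_one₀ hs1 (abs_nonneg _) ht
  have e1 := (norm_exp_mul_I_sub_quadratic_le (abs_le q hq0 hq1)).trans (bound_sq q hq0 hq1)
  have e2 := norm_exp_mul_I_sub_quadratic_le (x := -(p * t))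
    (by rw [abs_neg]; exact abs_le p hp0 hp1)
  rw [abs_neg] at e2
  replace e2 := e2.trans (bound_sq p hp0 hp1)
  have hpq0 : 0 ≤ p * q := by positivity
  have hpq1 : p * q ≤ 1 := mul_le_one₀ hp1 hq0 hq1
  have ht2 : t ^ 2 ≤ 1 := by rw [← sq_abs]; exact pow_le_one₀ (abs_nonneg _) ht
  have e3 : |Real.exp (-(p * q) * t ^ 2 / 2) - 1 - (-(p * q) * t ^ 2 / 2)| ≤
      p * q * |t| ^ 3 := by
    refine (Real.abs_exp_sub_one_sub_id_le ?_).trans ?_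
    · rw [abs_le']
      constructor <;> nlinarith [mul_le_one₀ hpq1 (sq_nonneg t) ht2, mul_nonneg hpq0 (sq_nonneg t)]
    · have h4 : (-(p * q) * t ^ 2 / 2) ^ 2 = p * q * (p * q) / 4 * |t| * |t| ^ 3 := by
        have : t ^ 4 = |t| * |t| ^ 3 := by
          rw [← pow_succ']; exact (Even.pow_abs ⟨2, rfl⟩ t).symm
        calc (-(p * q) * t ^ 2 / 2) ^ 2 = p * q * (p * q) / 4 * t ^ 4 := by ring
          _ = _ := by rw [this]; ring
      rw [h4]
      refine mul_le_mul_of_nonneg_right ?_ (by positivity)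
      have : p * q * |t| ≤ 1 := mul_le_one₀ hpq1 (abs_nonneg _) ht
      nlinarith [mul_nonneg hpq0 (abs_nonneg t)]
  rw [hform, hv]
  have key : (p : ℂ) * Complex.exp ((q * t : ℝ) * Complex.I) +
        q * Complex.exp ((-(p * t) : ℝ) * Complex.I) - (Real.exp (-(p * q) * t ^ 2 / 2) : ℝ) =
      p * (Complex.exp ((q * t : ℝ) * Complex.I) -
        (1 + (q * t : ℝ) * Complex.I - ((q * t : ℝ) : ℂ) ^ 2 / 2)) +
      q * (Complex.exp ((-(p * t) : ℝ) * Complex.I) -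
        (1 + (-(p * t) : ℝ) * Complex.I - ((-(p * t) : ℝ) : ℂ) ^ 2 / 2)) -
      ((Real.exp (-(p * q) * t ^ 2 / 2) - 1 - (-(p * q) * t ^ 2 / 2) : ℝ) : ℂ) := by
    have hpc : (p : ℂ) = 1 - q := by
      rw [← Complex.ofReal_one, ← Complex.ofReal_sub, ← hpq, add_sub_cancel_right]
    push_cast
    rw [hpc]
    ring
  rw [key]
  refine (norm_sub_le _ _).trans ?_
  refine (add_le_add (norm_add_le _ _) le_rfl).trans ?_
  rw [norm_mul, norm_mul, Complex.norm_real, Complex.norm_real, Complex.norm_real,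
    Real.norm_of_nonneg hp0, Real.norm_of_nonneg hq0, Real.norm_eq_abs]
  nlinarith [mul_le_mul_of_nonneg_left e1 hp0, mul_le_mul_of_nonneg_left e2 hq0]

/-- The characteristic function of a centred sum of independent Bernoulli variables with success
probabilities `1 / (1 + r i)`. -/
noncomputable def centeredSumCharFun {n : ℕ} (r : Fin n → ℝ) (t : ℝ) : ℂ :=
  ∏ i, centeredBernoulliCharFun (r i) t

lemma continuous_centeredSumCharFun {n : ℕ} (r : Fin n → ℝ) :
    Continuous (centeredSumCharFun r) :=
  continuous_finsetProd _ fun i _ => continuous_centeredBernoulliCharFun (r i)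

lemma natDegree_prod_X_add_C_lt {n : ℕ} (r : Fin n → ℝ) :
    (∏ i, (X + C (r i))).natDegree < n + 1 := by
  refine Nat.lt_succ_of_le ((natDegree_prod_le _ _).trans ?_)
  simp

lemma sum_coeff_prod_X_add_C {n : ℕ} (r : Fin n → ℝ) :
    ∑ j ∈ Finset.range (n + 1), (∏ i, (X + C (r i))).coeff j = ∏ i, (1 + r i) := by
  have h := eval_eq_sum_range' (natDegree_prod_X_add_C_lt r) 1
  simpa [eval_prod] using h.symm

lemma centeredSumCharFun_eq_sum {n : ℕ} (r : Fin n → ℝ) (t : ℝ) :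
    centeredSumCharFun r t =
      (∑ j ∈ Finset.range (n + 1), ((∏ i, (X + C (r i))).coeff j / ∏ i, (1 + r i) : ℝ) *
        Complex.exp (j * t * Complex.I)) *
      Complex.exp (-(t * ∑ i, 1 / (1 + r i) : ℝ) * Complex.I) := by
  have h := aeval_eq_sum_range' (natDegree_prod_X_add_C_lt r) (Complex.exp (t * Complex.I))
  rw [map_prod] at h
  simp only [map_add, aeval_X, aeval_C, Complex.coe_algebraMap, Complex.real_smul,
    ← Complex.exp_nat_mul] at h
  unfold centeredSumCharFun centeredBernoulliCharFun
  rw [Finset.prod_mul_distrib, Finset.prod_div_distrib, h, ← Complex.exp_sum, Finset.sum_div]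
  congr 1
  · refine Finset.sum_congr rfl fun j _ => ?_
    push_cast
    rw [mul_div_right_comm, mul_assoc (j : ℂ)]
  · congr 1
    rw [← Finset.sum_mul]
    congr 1
    push_cast
    rw [Finset.mul_sum, ← Finset.sum_neg_distrib]
    simp [div_eq_mul_inv]

lemma integral_exp_int_mul_I (m : ℤ) :
    ∫ t in (-Real.pi)..Real.pi, Complex.exp (m * Complex.I * t) =
      if m = 0 then 2 * (Real.pi : ℂ) else 0 := by
  split_ifs with hm
  · subst hm
    simp
    ring
  · rw [integral_exp_mul_complex (by simp [hm])]
    have h : Complex.exp (m * Complex.I * Real.pi) =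
        Complex.exp (m * Complex.I * (-Real.pi : ℝ)) := by
      rw [Complex.exp_eq_exp_iff_exists_int]
      exact ⟨m, by push_cast; ring⟩
    rw [h, sub_self, zero_div]

lemma integral_centeredSumCharFun_mul_exp {n : ℕ} (r : Fin n → ℝ) (k : ℤ) :
    ∫ t in (-Real.pi)..Real.pi, centeredSumCharFun r t *
        Complex.exp (-(t * (k - ∑ i, 1 / (1 + r i)) : ℝ) * Complex.I) =
      2 * Real.pi * ((if 0 ≤ k then (∏ i, (X + C (r i))).coeff k.toNat / ∏ i, (1 + r i) else 0 : ℝ) :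
        ℂ) := by
  have h : ∀ t : ℝ, centeredSumCharFun r t *
        Complex.exp (-(t * (k - ∑ i, 1 / (1 + r i)) : ℝ) * Complex.I) =
      ∑ j ∈ Finset.range (n + 1), ((∏ i, (X + C (r i))).coeff j / ∏ i, (1 + r i) : ℝ) *
        Complex.exp (((j - k : ℤ) : ℂ) * Complex.I * t) := by
    intro t
    rw [centeredSumCharFun_eq_sum, Finset.sum_mul, Finset.sum_mul]
    refine Finset.sum_congr rfl fun j _ => ?_
    rw [mul_assoc, mul_assoc, ← Complex.exp_add, ← Complex.exp_add]
    congr 2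
    push_cast
    ring
  simp_rw [h]
  rw [intervalIntegral.integral_finsetSum
    fun j _ => Continuous.intervalIntegrable (by fun_prop) _ _]
  simp_rw [intervalIntegral.integral_const_mul, integral_exp_int_mul_I]
  split_ifs with hk
  · lift k to ℕ using hk
    simp only [sub_eq_zero, Nat.cast_inj, mul_ite, mul_zero, Finset.sum_ite_eq', Int.toNat_natCast]
    split_ifs with hmem
    · ring
    · rw [coeff_eq_zero_of_natDegree_lt]
      · simp
      · have := natDegree_prod_X_add_C_lt r
        simp at hmem
        omega
  · rw [Finset.sum_eq_zero]
    · simp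
    · intro j _
      rw [if_neg (by omega), mul_zero]

lemma integral_exp_neg_sq_div_two_mul_exp (y : ℝ) :
    ∫ s : ℝ, (Real.exp (-s ^ 2 / 2) : ℂ) * Complex.exp (-(s * y : ℝ) * Complex.I) =
      2 * Real.pi * (((Real.sqrt (2 * Real.pi))⁻¹ * Real.exp (-y ^ 2 / 2) : ℝ) : ℂ) := by
  have h := fourierIntegral_gaussian (b := 1 / 2) (by norm_num) (-y)
  have hpi : (Real.pi : ℂ) / (1 / 2) = ((2 * Real.pi : ℝ) : ℂ) := by push_cast; ring
  have hsqrt : ((2 * Real.pi : ℝ) : ℂ) ^ (1 / 2 : ℂ) = (Real.sqrt (2 * Real.pi) : ℂ) := by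
    rw [Real.sqrt_eq_rpow, Complex.ofReal_cpow (by positivity)]
    norm_num
  have hinv : Real.sqrt (2 * Real.pi) = 2 * Real.pi * (Real.sqrt (2 * Real.pi))⁻¹ := by
    have h0 : (0 : ℝ) < 2 * Real.pi := by positivity
    rw [eq_mul_inv_iff_mul_eq₀ (by positivity), Real.mul_self_sqrt h0.le]
  rw [hpi, hsqrt, hinv] at h
  calc _ = ∫ s : ℝ, Complex.exp (Complex.I * -y * s) * Complex.exp (-(1 / 2) * s ^ 2) := by
        refine MeasureTheory.integral_congr_ae (MeasureTheory.ae_of_all _ fun s => ?_)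
        beta_reduce
        rw [mul_comm]
        push_cast
        congr 2 <;> ring
    _ = _ := by
        rw [h]
        push_cast
        rw [mul_assoc]
        congr 4 <;> norm_num

/-- The characteristic function of the standardized sum, truncated to one period. -/
noncomputable def truncatedCharFun {n : ℕ} (r : Fin n → ℝ) (σ s : ℝ) : ℂ :=
  (Set.Ioc (-(Real.pi * σ)) (Real.pi * σ)).indicator (fun s => centeredSumCharFun r (s / σ)) s

lemma integral_truncatedCharFun_mul_exp {n : ℕ} (r : Fin n → ℝ) {σ : ℝ} (hσ : 0 < σ) (k : ℤ) :
    ∫ s, truncatedCharFun r σ s *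
        Complex.exp (-(s * ((k - ∑ i, 1 / (1 + r i)) / σ) : ℝ) * Complex.I) =
      2 * Real.pi * ((σ * (if 0 ≤ k then
        (∏ i, (X + C (r i))).coeff k.toNat / ∏ i, (1 + r i) else 0) : ℝ) : ℂ) := by
  have h := intervalIntegral.integral_comp_div (a := -(Real.pi * σ)) (b := Real.pi * σ)
    (fun t => centeredSumCharFun r t *
      Complex.exp (-(t * (k - ∑ i, 1 / (1 + r i)) : ℝ) * Complex.I)) hσ.ne'
  rw [neg_div, mul_div_cancel_right₀ _ hσ.ne', integral_centeredSumCharFun_mul_exp,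
    intervalIntegral.integral_of_le (by nlinarith [mul_pos Real.pi_pos hσ]),
    ← MeasureTheory.integral_indicator measurableSet_Ioc] at h
  calc _ = _ := by
        refine MeasureTheory.integral_congr_ae (MeasureTheory.ae_of_all _ fun s => ?_)
        simp only [truncatedCharFun]
        by_cases hs : s ∈ Set.Ioc (-(Real.pi * σ)) (Real.pi * σ)
        · simp only [Set.indicator_of_mem hs, mul_div_assoc', div_mul_eq_mul_div]
        · simp only [Set.indicator_of_notMem hs, zero_mul]
    _ = _ := h
    _ = _ := by
        rw [Complex.real_smul]
        push_cast
        ring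

lemma measurable_truncatedCharFun {n : ℕ} (r : Fin n → ℝ) (σ : ℝ) :
    Measurable (truncatedCharFun r σ) :=
  (((continuous_centeredSumCharFun r).comp (continuous_id.div_const σ)).measurable).indicator
    measurableSet_Ioc

lemma norm_truncatedCharFun_le {n : ℕ} {r : Fin n → ℝ} (hr : ∀ i, 0 ≤ r i) {σ : ℝ} (hσ : 0 < σ)
    (hσ2 : σ ^ 2 = ∑ i, r i / (1 + r i) ^ 2) (s : ℝ) :
    ‖truncatedCharFun r σ s‖ ≤ Real.exp (-(2 / Real.pi ^ 2) * s ^ 2) := by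
  unfold truncatedCharFun
  by_cases hs : s ∈ Set.Ioc (-(Real.pi * σ)) (Real.pi * σ)
  · rw [Set.indicator_of_mem hs]
    have ht : |s / σ| ≤ Real.pi := by
      rw [abs_div, abs_of_pos hσ, div_le_iff₀ hσ, abs_le]
      exact ⟨hs.1.le, hs.2⟩
    rw [centeredSumCharFun, norm_prod]
    calc ∏ i, ‖centeredBernoulliCharFun (r i) (s / σ)‖
        ≤ ∏ i, Real.exp (-(2 / Real.pi ^ 2 * (s / σ) ^ 2) * (r i / (1 + r i) ^ 2)) :=
          Finset.prod_le_prod (fun _ _ => norm_nonneg _)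
            fun i _ => norm_centeredBernoulliCharFun_le (hr i) ht
      _ = Real.exp (-(2 / Real.pi ^ 2) * s ^ 2) := by
          rw [← Real.exp_sum, ← Finset.mul_sum, ← hσ2]
          congr 1
          field_simp
  · rw [Set.indicator_of_notMem hs, norm_zero]
    exact (Real.exp_pos _).le

lemma integrable_truncatedCharFun {n : ℕ} {r : Fin n → ℝ} (hr : ∀ i, 0 ≤ r i) {σ : ℝ}
    (hσ : 0 < σ) (hσ2 : σ ^ 2 = ∑ i, r i / (1 + r i) ^ 2) :
    MeasureTheory.Integrable (truncatedCharFun r σ) :=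
  (integrable_exp_neg_mul_sq (by positivity)).mono'
    (measurable_truncatedCharFun r σ).aestronglyMeasurable
    (MeasureTheory.ae_of_all _ (norm_truncatedCharFun_le hr hσ hσ2))

lemma integrable_ofReal_exp_neg_sq_div_two :
    MeasureTheory.Integrable (fun s : ℝ => ((Real.exp (-s ^ 2 / 2) : ℝ) : ℂ)) := by
  have h : MeasureTheory.Integrable (fun s : ℝ => Real.exp (-s ^ 2 / 2)) := by
    convert integrable_exp_neg_mul_sq (b := 1 / 2) (by norm_num) using 3
    ring
  exact h.ofReal

lemma integrable_mul_exp_mul_I {f : ℝ → ℂ} (hf : MeasureTheory.Integrable f) (y : ℝ) :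
    MeasureTheory.Integrable
      (fun s => f s * Complex.exp (-(s * y : ℝ) * Complex.I)) := by
  refine hf.mono (hf.aestronglyMeasurable.mul
    (Continuous.aestronglyMeasurable (by fun_prop))) (MeasureTheory.ae_of_all _ fun s => ?_)
  rw [norm_mul, ← Complex.ofReal_neg, Complex.norm_exp_ofReal_mul_I, mul_one]

lemma abs_mul_coeff_sub_gaussian_le {n : ℕ} {r : Fin n → ℝ} (hr : ∀ i, 0 ≤ r i) {σ : ℝ}
    (hσ : 0 < σ) (hσ2 : σ ^ 2 = ∑ i, r i / (1 + r i) ^ 2) (k : ℤ) :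
    |σ * (if 0 ≤ k then (∏ i, (X + C (r i))).coeff k.toNat / ∏ i, (1 + r i) else 0) -
        (Real.sqrt (2 * Real.pi))⁻¹ *
          Real.exp (-((k - ∑ i, 1 / (1 + r i)) / σ) ^ 2 / 2)| ≤
      (2 * Real.pi)⁻¹ *
        ∫ s, ‖truncatedCharFun r σ s - ((Real.exp (-s ^ 2 / 2) : ℝ) : ℂ)‖ := by
  have h1 := integral_truncatedCharFun_mul_exp r hσ k
  have h2 := integral_exp_neg_sq_div_two_mul_exp ((k - ∑ i, 1 / (1 + r i)) / σ)
  have h := congrArg norm (congrArg₂ (· - ·) h1 h2)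
  rw [← MeasureTheory.integral_sub
    (integrable_mul_exp_mul_I (integrable_truncatedCharFun hr hσ hσ2) _)
    (integrable_mul_exp_mul_I integrable_ofReal_exp_neg_sq_div_two _), ← mul_sub,
    ← Complex.ofReal_sub, norm_mul, Complex.norm_real, Real.norm_eq_abs] at h
  have hpi : ‖(2 * Real.pi : ℂ)‖ = 2 * Real.pi := by
    simp [abs_of_pos Real.pi_pos]
  rw [hpi] at h
  rw [le_inv_mul_iff₀ (by positivity), ← h]
  refine (MeasureTheory.norm_integral_le_integral_norm _).trans_eq ?_
  refine MeasureTheory.integral_congr_ae (MeasureTheory.ae_of_all _ fun s => ?_)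
  simp only
  rw [← sub_mul, norm_mul, ← Complex.ofReal_neg, Complex.norm_exp_ofReal_mul_I, mul_one]

lemma abs_exp_neg_sq_div_two_sub_le (x y : ℝ) :
    |Real.exp (-y ^ 2 / 2) - Real.exp (-x ^ 2 / 2)| ≤ |y - x| := by
  have hderiv : ∀ z : ℝ, HasDerivAt (fun z : ℝ => Real.exp (-z ^ 2 / 2))
      (Real.exp (-z ^ 2 / 2) * -z) z := by
    intro z
    have h := (((hasDerivAt_pow 2 z).neg.div_const 2).exp)
    refine h.congr_deriv ?_
    simp only [Pi.neg_apply]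
    push_cast
    ring
  have h := Convex.norm_image_sub_le_of_norm_deriv_le (𝕜 := ℝ) (C := 1) (s := Set.univ)
    (f := fun z : ℝ => Real.exp (-z ^ 2 / 2)) (x := x) (y := y)
    (fun z _ => (hderiv z).differentiableAt) ?_ convex_univ (Set.mem_univ _) (Set.mem_univ _)
  · simpa using h
  · intro z _
    rw [(hderiv z).deriv, norm_mul, norm_neg, Real.norm_of_nonneg (Real.exp_pos _).le,
      Real.norm_eq_abs, neg_div, Real.exp_neg, inv_mul_le_iff₀ (Real.exp_pos _), mul_one]
    refine le_trans ?_ (Real.add_one_le_exp _)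
    nlinarith [sq_nonneg (|z| - 1), sq_abs z]

lemma norm_centeredSumCharFun_sub_gaussian_le {n : ℕ} {r : Fin n → ℝ} (hr : ∀ i, 0 ≤ r i)
    {σ : ℝ} (hσ : 0 < σ) (hσ2 : σ ^ 2 = ∑ i, r i / (1 + r i) ^ 2) {s : ℝ} (hs : |s| ≤ σ) :
    ‖centeredSumCharFun r (s / σ) - ((Real.exp (-s ^ 2 / 2) : ℝ) : ℂ)‖ ≤ 7 * |s| ^ 3 / σ := by
  have ht : |s / σ| ≤ 1 := by
    rw [abs_div, abs_of_pos hσ, div_le_one hσ]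
    exact hs
  have hv : ∀ i, 0 ≤ r i / (1 + r i) ^ 2 := fun i =>
    div_nonneg (hr i) (sq_nonneg _)
  have hexp : ((Real.exp (-s ^ 2 / 2) : ℝ) : ℂ) =
      ∏ i, ((Real.exp (-(r i / (1 + r i) ^ 2) * (s / σ) ^ 2 / 2) : ℝ) : ℂ) := by
    rw [← Complex.ofReal_prod, ← Real.exp_sum, ← Finset.sum_div, ← Finset.sum_mul,
      Finset.sum_neg_distrib, ← hσ2]
    congr 3
    field_simp
  rw [hexp, centeredSumCharFun]
  refine (norm_prod_sub_prod_le_sum _ _ _ (fun i _ => ?_) (fun i _ => ?_)).trans ?_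
  · refine (norm_centeredBernoulliCharFun_le (hr i)
      (ht.trans (by linarith [Real.pi_gt_three]))).trans ?_
    rw [Real.exp_le_one_iff, neg_mul, neg_nonpos]
    exact mul_nonneg (by positivity) (hv i)
  · rw [Complex.norm_real, Real.norm_of_nonneg (Real.exp_pos _).le, Real.exp_le_one_iff]
    have := mul_nonneg (hv i) (sq_nonneg (s / σ))
    linarith
  · calc _ ≤ ∑ i, 7 * (r i / (1 + r i) ^ 2) * |s / σ| ^ 3 :=
          Finset.sum_le_sum fun i _ => norm_centeredBernoulliCharFun_sub_exp_le (hr i) ht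
      _ = 7 * |s| ^ 3 / σ := by
          rw [← Finset.sum_mul, ← Finset.mul_sum, ← hσ2, abs_div, abs_of_pos hσ]
          field_simp

lemma tendsto_integral_norm_truncatedCharFun_sub_gaussian
    {r : (n : ℕ) → Fin n → ℝ} (hr : ∀ n i, 0 ≤ r n i) {σ : ℕ → ℝ}
    (hσ : ∀ n, σ n ^ 2 = ∑ i : Fin n, r n i / (1 + r n i) ^ 2)
    (hσtop : Tendsto σ atTop atTop) :
    Tendsto (fun n => ∫ s, ‖truncatedCharFun (r n) (σ n) s - ((Real.exp (-s ^ 2 / 2) : ℝ) : ℂ)‖)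
      atTop (nhds 0) := by
  rw [← MeasureTheory.integral_zero ℝ ℝ]
  refine MeasureTheory.tendsto_integral_filter_of_dominated_convergence
    (fun s => Real.exp (-(2 / Real.pi ^ 2) * s ^ 2) + ‖((Real.exp (-s ^ 2 / 2) : ℝ) : ℂ)‖)
    ?_ ?_ ?_ ?_
  · refine Eventually.of_forall fun n => ?_
    exact ((measurable_truncatedCharFun _ _).aestronglyMeasurable.sub
      integrable_ofReal_exp_neg_sq_div_two.aestronglyMeasurable).norm
  · filter_upwards [hσtop.eventually_gt_atTop 0] with n hn
    refine MeasureTheory.ae_of_all _ fun s => ?_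
    rw [norm_norm]
    exact (norm_sub_le _ _).trans
      (add_le_add_left (norm_truncatedCharFun_le (hr n) hn (hσ n) s) _)
  · exact (integrable_exp_neg_mul_sq (by positivity)).add
      integrable_ofReal_exp_neg_sq_div_two.norm
  · refine MeasureTheory.ae_of_all _ fun s => ?_
    refine squeeze_zero' (Eventually.of_forall fun _ => norm_nonneg _) ?_
      (tendsto_const_nhds.div_atTop hσtop : Tendsto (fun n => 7 * |s| ^ 3 / σ n) atTop (nhds 0))
    filter_upwards [hσtop.eventually_gt_atTop 0, hσtop.eventually_ge_atTop |s|] with n hn hs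
    have hmem : s ∈ Set.Ioc (-(Real.pi * σ n)) (Real.pi * σ n) := by
      have h3 : σ n < Real.pi * σ n := by nlinarith [Real.pi_gt_three]
      rw [abs_le] at hs
      exact ⟨by linarith, by linarith⟩
    rw [truncatedCharFun, Set.indicator_of_mem hmem]
    exact norm_centeredSumCharFun_sub_gaussian_le (hr n) hn (hσ n) hs

/-- Harper's criterion, local limit theorem part. -/
theorem laplacian_llt_criterion
    (r : (n : ℕ) → Fin n → ℝ) (hr : ∀ n i, 0 ≤ r n i)
    (a : ℕ → ℕ → ℝ)
    (ha : ∀ n k, a n k = (∏ i : Fin n, (X + C (r n i))).coeff k)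
    (μ σ : ℕ → ℝ)
    (hμ : ∀ n, μ n = ∑ i : Fin n, 1 / (1 + r n i))
    (hσ : ∀ n, σ n ^ 2 = ∑ i : Fin n, r n i / (1 + r n i) ^ 2)
    (hσ0 : ∀ n, 0 ≤ σ n)
    (hσtop : Tendsto σ atTop atTop) :
    Tendsto (fun n : ℕ => ⨆ x : ℝ,
      |σ n * (if 0 ≤ ⌊μ n + x * σ n⌋ then
            a n (⌊μ n + x * σ n⌋).toNat / (∑ j ∈ Finset.range (n + 1), a n j) else 0)
        - (Real.sqrt (2 * Real.pi))⁻¹ * Real.exp (-x ^ 2 / 2)|)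
      atTop (nhds 0) := by
  have hlim : Tendsto (fun n => (2 * Real.pi)⁻¹ *
      (∫ s, ‖truncatedCharFun (r n) (σ n) s - ((Real.exp (-s ^ 2 / 2) : ℝ) : ℂ)‖) +
      (Real.sqrt (2 * Real.pi))⁻¹ / σ n) atTop (nhds 0) := by
    simpa using ((tendsto_integral_norm_truncatedCharFun_sub_gaussian hr hσ hσtop).const_mul
      (2 * Real.pi)⁻¹).add (tendsto_const_nhds.div_atTop hσtop)
  refine squeeze_zero' (Eventually.of_forall fun n => Real.iSup_nonneg fun _ => abs_nonneg _) ?_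
    hlim
  filter_upwards [hσtop.eventually_gt_atTop 0] with n hn
  refine ciSup_le fun x => ?_
  set k : ℤ := ⌊μ n + x * σ n⌋ with hk
  have hclose : |(k - μ n) / σ n - x| ≤ 1 / σ n := by
    have heq : (k - μ n) / σ n - x = (k - (μ n + x * σ n)) / σ n := by
      field_simp
      ring
    rw [heq, abs_div, abs_of_pos hn]
    gcongr
    rw [abs_le]
    exact ⟨by linarith [Int.lt_floor_add_one (μ n + x * σ n)],
      by linarith [Int.floor_le (μ n + x * σ n)]⟩
  have hfourier := abs_mul_coeff_sub_gaussian_le (hr n) hn (hσ n) k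
  rw [← hμ n] at hfourier
  simp only [ha, sum_coeff_prod_X_add_C]
  refine (abs_sub_le _ _ _).trans (add_le_add hfourier ?_)
  rw [← mul_sub, abs_mul, abs_of_nonneg (by positivity), div_eq_mul_one_div (√_)⁻¹]
  exact mul_le_mul_of_nonneg_left
    ((abs_exp_neg_sq_div_two_sub_le _ _).trans hclose) (by positivity)
end

section
/- Let $\{G_n\}_{n=1}^{\infty}$ be a sequence of finite simple graphs such that the number of edges $|E(G_n)|$ increases with $n$ and $\Delta^2(G_n)=o(|E(G_n)|)$ as $n\to\infty$, where $\Delta(G_n)$ is the maximum vertex degree of $G_n$. Then the Laplacian coefficients $c(G_n,k)$ are asymptotically normal by central and local limit theorems, with mean $\mu_n=\sum_{i}\frac{1}{1+\lambda_i(G_n)}$ and variance $\sigma_n^2=\sum_{i}\frac{\lambda_i(G_n)}{(1+\lambda_i(G_n))^2}$, where $\lambda_1(G_n),\dots,\lambda_{|V(G_n)|}(G_n)$ are the eigenvalues of the Laplacian matrix of $G_n$. -/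
open Filter Finset Polynomial
open scoped Classical

namespace PoissonBinomial

variable {ι : Type*} [Fintype ι]

/-- The generating polynomial of a sum of independent Bernoulli variables with parameters `p i`. -/
noncomputable def genPoly (p : ι → ℝ) : ℝ[X] := ∏ i, (C (1 - p i) + C (p i) * X)

/-- The mass function of a sum of independent Bernoulli variables, on the integers. -/
noncomputable def mass (p : ι → ℝ) (m : ℤ) : ℝ := if 0 ≤ m then (genPoly p).coeff m.toNat else 0

/-- The characteristic function of the centred sum of independent Bernoulli variables. -/
noncomputable def centredChar (p : ι → ℝ) (t : ℝ) : ℂ :=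
  ∏ i, ((1 - p i : ℝ) * Complex.exp ((-(p i * t) : ℝ) * Complex.I)
    + (p i : ℝ) * Complex.exp (((1 - p i) * t : ℝ) * Complex.I))

/-- The variance of a sum of independent Bernoulli variables. -/
noncomputable def var (p : ι → ℝ) : ℝ := ∑ i, p i * (1 - p i)

/-- The rescaled characteristic function, cut off to one period. -/
noncomputable def truncChar (p : ι → ℝ) (σ : ℝ) : ℝ → ℂ :=
  (Set.Ioc (-(Real.pi * σ)) (Real.pi * σ)).indicator fun s => centredChar p (s / σ)

/-- The standard Gaussian density. -/
noncomputable def gauss (x : ℝ) : ℝ := (Real.sqrt (2 * Real.pi))⁻¹ * Real.exp (-x ^ 2 / 2)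

lemma genPoly_natDegree_lt (p : ι → ℝ) : (genPoly p).natDegree < Fintype.card ι + 1 := by
  refine Nat.lt_succ_of_le ((natDegree_prod_le _ _).trans ?_)
  refine (Finset.sum_le_card_nsmul _ _ 1 fun i _ => ?_).trans (by simp)
  refine (natDegree_add_le _ _).trans ?_
  simp only [natDegree_C, zero_le, sup_of_le_right]
  exact (natDegree_C_mul_le _ _).trans natDegree_X_le

lemma centredChar_eq_sum (p : ι → ℝ) (t : ℝ) :
    centredChar p t = Complex.exp ((-((∑ i, p i) * t) : ℝ) * Complex.I) *
      ∑ k ∈ range (Fintype.card ι + 1), ((genPoly p).coeff k : ℂ) *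
        Complex.exp ((k * t : ℝ) * Complex.I) := by
  have h : ∑ k ∈ range (Fintype.card ι + 1), ((genPoly p).coeff k : ℂ) *
        Complex.exp ((k * t : ℝ) * Complex.I) =
      (genPoly p).eval₂ Complex.ofRealHom (Complex.exp (t * Complex.I)) := by
    rw [Polynomial.eval₂_eq_sum_range' _ (genPoly_natDegree_lt p)]
    refine Finset.sum_congr rfl fun k _ => ?_
    rw [← Complex.exp_nat_mul]
    push_cast
    simp [mul_assoc]
  rw [h, genPoly, Polynomial.eval₂_finsetProd, centredChar, Finset.sum_mul, ← Finset.sum_neg_distrib,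
    Complex.ofReal_sum, Finset.sum_mul, Complex.exp_sum, ← Finset.prod_mul_distrib]
  refine Finset.prod_congr rfl fun i _ => ?_
  simp only [eval₂_add, eval₂_C, eval₂_mul, eval₂_X, Complex.ofRealHom_eq_coe]
  rw [mul_add, mul_comm (Complex.exp _), mul_left_comm (Complex.exp _), ← Complex.exp_add]
  congr 4
  push_cast
  ring

lemma integral_exp_int_mul (n : ℤ) :
    ∫ t in (-Real.pi)..Real.pi, Complex.exp ((n * t : ℝ) * Complex.I) =
      if n = 0 then (2 * Real.pi : ℂ) else 0 := by
  split_ifs with h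
  · simp [h]; ring
  · have hc : (n * Complex.I : ℂ) ≠ 0 := by simp [h]
    have := integral_exp_mul_complex (a := -Real.pi) (b := Real.pi) hc
    rw [show (fun t : ℝ => Complex.exp ((n * t : ℝ) * Complex.I)) =
      fun t : ℝ => Complex.exp (n * Complex.I * t) by
        ext t; push_cast; ring_nf, this, div_eq_zero_iff]
    left
    rw [sub_eq_zero, Complex.exp_eq_exp_iff_exists_int]
    exact ⟨n, by push_cast; ring⟩

lemma mass_eq_sum (p : ι → ℝ) (m : ℤ) :
    mass p m = ∑ k ∈ range (Fintype.card ι + 1), (genPoly p).coeff k * if (k : ℤ) = m then 1 else 0 := by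
  rw [mass]
  split_ifs with h
  · lift m to ℕ using h
    simp only [Int.toNat_natCast, Nat.cast_inj, mul_ite, mul_one, mul_zero]
    rw [Finset.sum_ite_eq']
    split_ifs with h'
    · rfl
    · exact coeff_eq_zero_of_natDegree_lt ((genPoly_natDegree_lt p).trans_le (by simpa using h'))
  · refine (Finset.sum_eq_zero fun k _ => ?_).symm
    rw [if_neg (by omega), mul_zero]

/-- Fourier inversion for the mass function. -/
lemma integral_centredChar (p : ι → ℝ) (m : ℤ) :
    ∫ t in (-Real.pi)..Real.pi,
      centredChar p t * Complex.exp ((-((m - ∑ i, p i) * t) : ℝ) * Complex.I) =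
      2 * Real.pi * mass p m := by
  have h : ∀ t : ℝ, centredChar p t * Complex.exp ((-((m - ∑ i, p i) * t) : ℝ) * Complex.I) =
      ∑ k ∈ range (Fintype.card ι + 1), ((genPoly p).coeff k : ℂ) *
        Complex.exp ((((k - m : ℤ) : ℝ) * t : ℝ) * Complex.I) := by
    intro t
    rw [centredChar_eq_sum, mul_right_comm, ← Complex.exp_add, Finset.mul_sum]
    refine Finset.sum_congr rfl fun k _ => ?_
    rw [mul_left_comm, ← Complex.exp_add]
    congr 2
    push_cast
    ring
  simp_rw [h]
  rw [intervalIntegral.integral_finsetSum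
    fun k _ => Continuous.intervalIntegrable (by fun_prop) _ _]
  simp_rw [intervalIntegral.integral_const_mul, integral_exp_int_mul, mass_eq_sum]
  push_cast
  rw [Finset.mul_sum]
  refine Finset.sum_congr rfl fun k _ => ?_
  simp only [sub_eq_zero]
  split_ifs <;> simp; ring

lemma gauss_eq_integral (x : ℝ) :
    ∫ s : ℝ, Complex.exp (-(s : ℂ) ^ 2 / 2) * Complex.exp ((-(x * s) : ℝ) * Complex.I) =
      2 * Real.pi * gauss x := by
  have h := fourierIntegral_gaussian (b := 1 / 2) (by norm_num) (-x)
  have e : (fun s : ℝ => Complex.exp (-(s : ℂ) ^ 2 / 2) *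
      Complex.exp ((-(x * s) : ℝ) * Complex.I)) =
      fun s : ℝ => Complex.exp (Complex.I * (-x) * s) * Complex.exp (-(1 / 2) * (s : ℂ) ^ 2) := by
    ext s
    rw [mul_comm]
    push_cast
    congr 2 <;> ring
  rw [e, h, gauss, show (Real.pi / (1 / 2) : ℂ) = ((2 * Real.pi : ℝ) : ℂ) by push_cast; ring,
    show (1 / 2 : ℂ) = ((1 / 2 : ℝ) : ℂ) by push_cast; ring,
    ← Complex.ofReal_cpow (by positivity), ← Real.sqrt_eq_rpow]
  have h2 : Real.sqrt (2 * Real.pi) = 2 * Real.pi * (Real.sqrt (2 * Real.pi))⁻¹ := by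
    rw [← div_eq_mul_inv, Real.div_sqrt]
  have h3 : (-(-(x : ℂ)) ^ 2 / (4 * ((1 / 2 : ℝ) : ℂ))) = ((-x ^ 2 / 2 : ℝ) : ℂ) := by
    push_cast
    ring
  rw [h3, ← Complex.ofReal_exp]
  norm_cast
  rw [← mul_assoc, ← h2]

@[fun_prop]
lemma continuous_centredChar (p : ι → ℝ) : Continuous (centredChar p) := by
  unfold centredChar
  fun_prop

lemma integrable_truncChar (p : ι → ℝ) (σ : ℝ) : MeasureTheory.Integrable (truncChar p σ) := by
  rw [truncChar, MeasureTheory.integrable_indicator_iff measurableSet_Ioc]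
  exact (Continuous.integrableOn_Icc (by fun_prop)).mono_set Set.Ioc_subset_Icc_self

lemma integrable_cexp_neg_sq_div_two :
    MeasureTheory.Integrable fun s : ℝ => Complex.exp (-(s : ℂ) ^ 2 / 2) := by
  convert integrable_cexp_neg_mul_sq (b := 1 / 2) (by norm_num) using 3
  ring

/-- The Fourier-analytic bound on the error in the local limit theorem. -/
noncomputable def charError (p : ι → ℝ) (σ : ℝ) : ℝ :=
  (2 * Real.pi)⁻¹ * ∫ s : ℝ, ‖truncChar p σ s - Complex.exp (-(s : ℂ) ^ 2 / 2)‖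

lemma integral_truncChar (p : ι → ℝ) {σ : ℝ} (hσ : 0 < σ) (m : ℤ) :
    ∫ s : ℝ, truncChar p σ s * Complex.exp ((-((m - ∑ i, p i) / σ * s) : ℝ) * Complex.I) =
      2 * Real.pi * (σ * mass p m) := by
  have h : (fun s : ℝ => truncChar p σ s *
      Complex.exp ((-((m - ∑ i, p i) / σ * s) : ℝ) * Complex.I)) =
      (Set.Ioc (-(Real.pi * σ)) (Real.pi * σ)).indicator fun s =>
        (fun t : ℝ => centredChar p t *
          Complex.exp ((-((m - ∑ i, p i) * t) : ℝ) * Complex.I)) (s / σ) := by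
    ext s
    rw [truncChar]
    by_cases hs : s ∈ Set.Ioc (-(Real.pi * σ)) (Real.pi * σ)
    · simp only [Set.indicator_of_mem hs]
      congr 5
      ring
    · simp only [Set.indicator_of_notMem hs, zero_mul]
  have hle : -(Real.pi * σ) ≤ Real.pi * σ := by
    have := mul_pos Real.pi_pos hσ
    linarith
  rw [h, MeasureTheory.integral_indicator measurableSet_Ioc,
    ← intervalIntegral.integral_of_le hle, intervalIntegral.integral_comp_div
      (fun t : ℝ => centredChar p t *
        Complex.exp ((-((m - ∑ i, p i) * t) : ℝ) * Complex.I)) hσ.ne',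
    neg_div, mul_div_cancel_right₀ _ hσ.ne', integral_centredChar, Complex.real_smul]
  ring

lemma abs_mass_sub_gauss_le (p : ι → ℝ) {σ : ℝ} (hσ : 0 < σ) (m : ℤ) :
    |σ * mass p m - gauss ((m - ∑ i, p i) / σ)| ≤ charError p σ := by
  set x : ℝ := (m - ∑ i, p i) / σ
  have hnorm : ∀ s : ℝ, ‖Complex.exp ((-(x * s) : ℝ) * Complex.I)‖ = 1 := fun s =>
    Complex.norm_exp_ofReal_mul_I _
  have hmeas : MeasureTheory.AEStronglyMeasurable
      (fun s : ℝ => Complex.exp ((-(x * s) : ℝ) * Complex.I)) :=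
    Continuous.aestronglyMeasurable (by fun_prop)
  have i1 := (integrable_truncChar p σ).mul_bdd (c := 1) hmeas
    (Eventually.of_forall fun s => (hnorm s).le)
  have i2 := integrable_cexp_neg_sq_div_two.mul_bdd (c := 1) hmeas
    (Eventually.of_forall fun s => (hnorm s).le)
  have key : ∫ s : ℝ, (truncChar p σ s - Complex.exp (-(s : ℂ) ^ 2 / 2)) *
      Complex.exp ((-(x * s) : ℝ) * Complex.I) =
      ((2 * Real.pi * (σ * mass p m - gauss x) : ℝ) : ℂ) := by
    simp_rw [sub_mul]
    rw [MeasureTheory.integral_sub i1 i2, integral_truncChar p hσ, gauss_eq_integral]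
    push_cast
    ring
  have h := MeasureTheory.norm_integral_le_integral_norm
    (μ := MeasureTheory.volume) (fun s : ℝ =>
    (truncChar p σ s - Complex.exp (-(s : ℂ) ^ 2 / 2)) * Complex.exp ((-(x * s) : ℝ) * Complex.I))
  simp only [key, norm_mul, hnorm, mul_one, Complex.norm_real, Real.norm_eq_abs, Nat.abs_ofNat,
    abs_of_pos Real.pi_pos] at h
  rw [charError, le_inv_mul_iff₀ (by positivity)]
  exact h

lemma norm_factor_sq (p t : ℝ) :
    ‖((1 - p : ℝ) * Complex.exp ((-(p * t) : ℝ) * Complex.I)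
      + (p : ℝ) * Complex.exp (((1 - p) * t : ℝ) * Complex.I) : ℂ)‖ ^ 2 =
      1 - 2 * (p * (1 - p)) * (1 - Real.cos t) := by
  have h : ((1 - p : ℝ) * Complex.exp ((-(p * t) : ℝ) * Complex.I)
      + (p : ℝ) * Complex.exp (((1 - p) * t : ℝ) * Complex.I) : ℂ) =
      Complex.exp ((-(p * t) : ℝ) * Complex.I) * ((1 - p : ℝ) + p * Complex.exp (t * Complex.I)) := by
    rw [mul_add, mul_left_comm _ (p : ℂ), ← Complex.exp_add, mul_comm]
    congr 3
    push_cast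
    ring
  rw [h, norm_mul, Complex.norm_exp_ofReal_mul_I, one_mul, ← Complex.normSq_eq_norm_sq,
    Complex.exp_mul_I, Complex.normSq_apply]
  simp [← Complex.ofReal_cos, ← Complex.ofReal_sin]
  linear_combination p ^ 2 * Real.sin_sq_add_cos_sq t

lemma norm_factor_le_one {p : ℝ} (h0 : 0 ≤ p) (h1 : p ≤ 1) (t : ℝ) :
    ‖((1 - p : ℝ) * Complex.exp ((-(p * t) : ℝ) * Complex.I)
      + (p : ℝ) * Complex.exp (((1 - p) * t : ℝ) * Complex.I) : ℂ)‖ ≤ 1 := by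
  rw [← sq_le_one_iff₀ (norm_nonneg _), norm_factor_sq]
  have := mul_nonneg (mul_nonneg h0 (sub_nonneg.2 h1)) (sub_nonneg.2 (Real.cos_le_one t))
  linarith

lemma norm_centredChar_le {p : ι → ℝ} (h0 : ∀ i, 0 ≤ p i) (h1 : ∀ i, p i ≤ 1) {t : ℝ}
    (ht : |t| ≤ Real.pi) :
    ‖centredChar p t‖ ≤ Real.exp (-(2 / Real.pi ^ 2) * (var p * t ^ 2)) := by
  rw [← sq_le_sq₀ (norm_nonneg _) (Real.exp_pos _).le, centredChar, norm_prod, ← Finset.prod_pow,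
    ← Real.exp_nat_mul, var, Finset.sum_mul, Finset.mul_sum, Finset.mul_sum, Real.exp_sum]
  refine Finset.prod_le_prod (fun i _ => by positivity) fun i _ => ?_
  rw [norm_factor_sq]
  refine le_trans ?_ (Real.add_one_le_exp _)
  have := mul_le_mul_of_nonneg_left (Real.cos_le_one_sub_mul_cos_sq ht)
    (mul_nonneg (h0 i) (sub_nonneg.2 (h1 i)))
  push_cast
  linarith

lemma norm_truncChar_le {p : ι → ℝ} (h0 : ∀ i, 0 ≤ p i) (h1 : ∀ i, p i ≤ 1) {σ : ℝ} (hσ : 0 < σ)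
    (hv : σ ^ 2 = var p) (s : ℝ) :
    ‖truncChar p σ s‖ ≤ Real.exp (-(2 / Real.pi ^ 2) * s ^ 2) := by
  rw [truncChar, Set.indicator_apply]
  split_ifs with hs
  · refine (norm_centredChar_le h0 h1 ?_).trans_eq ?_
    · rw [abs_div, abs_of_pos hσ, div_le_iff₀ hσ, abs_le]
      exact ⟨hs.1.le, hs.2⟩
    · rw [← hv, ← mul_pow, mul_div_cancel₀ _ hσ.ne']
  · simpa using (Real.exp_pos _).le

lemma norm_prod_sub_prod_le {κ : Type*} (s : Finset κ) (a b : κ → ℂ) (ha : ∀ i ∈ s, ‖a i‖ ≤ 1)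
    (hb : ∀ i ∈ s, ‖b i‖ ≤ 1) : ‖∏ i ∈ s, a i - ∏ i ∈ s, b i‖ ≤ ∑ i ∈ s, ‖a i - b i‖ := by
  induction s using Finset.induction_on with
  | empty => simp
  | insert j s hj ih =>
    rw [Finset.prod_insert hj, Finset.prod_insert hj, Finset.sum_insert hj]
    have hs := ih (fun i hi => ha i (mem_insert_of_mem hi)) fun i hi => hb i (mem_insert_of_mem hi)
    have hp : ‖∏ i ∈ s, b i‖ ≤ 1 := by
      rw [norm_prod]
      exact Finset.prod_le_one (fun _ _ => norm_nonneg _) fun i hi => hb i (mem_insert_of_mem hi)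
    calc ‖a j * ∏ i ∈ s, a i - b j * ∏ i ∈ s, b i‖
        = ‖(a j - b j) * ∏ i ∈ s, b i + a j * (∏ i ∈ s, a i - ∏ i ∈ s, b i)‖ := by ring_nf
      _ ≤ ‖a j - b j‖ * 1 + 1 * ∑ i ∈ s, ‖a i - b i‖ := by
        refine (norm_add_le _ _).trans ?_
        rw [norm_mul, norm_mul]
        gcongr
        exact ha j (mem_insert_self _ _)
      _ = _ := by ring

lemma norm_exp_ofReal_mul_I_sub_le {y : ℝ} (hy : |y| ≤ 1) :
    ‖Complex.exp (y * Complex.I) - (1 + y * Complex.I - y ^ 2 / 2)‖ ≤ |y| ^ 3 := by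
  have hn : ‖(y * Complex.I : ℂ)‖ = |y| := by simp
  have h := Complex.exp_bound (x := y * Complex.I) (by rwa [hn]) (n := 3) (by norm_num)
  rw [hn] at h
  have e : ∑ m ∈ range 3, (y * Complex.I : ℂ) ^ m / (m.factorial : ℂ) =
      1 + y * Complex.I - y ^ 2 / 2 := by
    simp [Finset.sum_range_succ, Nat.factorial, mul_pow]
    ring
  rw [e] at h
  refine h.trans (mul_le_of_le_one_right (by positivity) ?_)
  norm_num [Nat.factorial]

lemma norm_factor_sub_le {p t : ℝ} (h0 : 0 ≤ p) (h1 : p ≤ 1) (ht : |t| ≤ 1) :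
    ‖((1 - p : ℝ) * Complex.exp ((-(p * t) : ℝ) * Complex.I)
      + (p : ℝ) * Complex.exp (((1 - p) * t : ℝ) * Complex.I) : ℂ)
      - (Real.exp (-(p * (1 - p) * t ^ 2 / 2)) : ℝ)‖ ≤ p * (1 - p) * (|t| ^ 3 + t ^ 4) := by
  have hq : 0 ≤ 1 - p := sub_nonneg.2 h1
  have hpq : 0 ≤ p * (1 - p) := mul_nonneg h0 hq
  have ht2 : t ^ 2 ≤ 1 := by rw [← sq_abs]; exact pow_le_one₀ (abs_nonneg _) ht
  have a1 : |(-(p * t))| = p * |t| := by rw [abs_neg, abs_mul, abs_of_nonneg h0]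
  have a2 : |(1 - p) * t| = (1 - p) * |t| := by rw [abs_mul, abs_of_nonneg hq]
  have b1 := norm_exp_ofReal_mul_I_sub_le (y := -(p * t))
    (by rw [a1]; exact mul_le_one₀ h1 (abs_nonneg _) ht)
  have b2 := norm_exp_ofReal_mul_I_sub_le (y := (1 - p) * t)
    (by rw [a2]; exact mul_le_one₀ (by linarith) (abs_nonneg _) ht)
  have hv : p * (1 - p) ≤ 1 := mul_le_one₀ h1 hq (by linarith)
  have b3 := Real.abs_exp_sub_one_sub_id_le (x := -(p * (1 - p) * t ^ 2 / 2)) (by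
    rw [abs_neg, abs_of_nonneg (by positivity)]
    have := mul_le_one₀ hv (sq_nonneg t) ht2
    linarith)
  rw [a1] at b1
  rw [a2] at b2
  have b4 : (-(p * (1 - p) * t ^ 2 / 2)) ^ 2 ≤ p * (1 - p) * t ^ 4 := by
    have : (-(p * (1 - p) * t ^ 2 / 2)) ^ 2 = p * (1 - p) * (p * (1 - p)) * t ^ 4 / 4 := by ring
    have h3 := mul_le_mul_of_nonneg_right (mul_le_of_le_one_right hpq hv)
      (show 0 ≤ t ^ 4 by positivity)
    have h4 : 0 ≤ p * (1 - p) * (p * (1 - p)) * t ^ 4 := by positivity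
    rw [this]
    linarith
  have b5 : (1 - p) * (p * |t|) ^ 3 + p * ((1 - p) * |t|) ^ 3 ≤ p * (1 - p) * |t| ^ 3 := by
    have : (1 - p) * (p * |t|) ^ 3 + p * ((1 - p) * |t|) ^ 3 =
      p * (1 - p) * |t| ^ 3 * (1 - 2 * (p * (1 - p))) := by ring
    rw [this]
    exact mul_le_of_le_one_right (by positivity) (by linarith)
  set E₁ := Complex.exp ((-(p * t) : ℝ) * Complex.I)
  set E₂ := Complex.exp (((1 - p) * t : ℝ) * Complex.I)
  set E₃ := Real.exp (-(p * (1 - p) * t ^ 2 / 2))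
  have e : ((1 - p : ℝ) * E₁ + (p : ℝ) * E₂ - (E₃ : ℝ) : ℂ) =
      (1 - p : ℝ) * (E₁ - (1 + (-(p * t) : ℝ) * Complex.I - ((-(p * t) : ℝ) : ℂ) ^ 2 / 2))
      + (p : ℝ) * (E₂ - (1 + ((1 - p) * t : ℝ) * Complex.I - (((1 - p) * t : ℝ) : ℂ) ^ 2 / 2))
      - ((E₃ - 1 - (-(p * (1 - p) * t ^ 2 / 2)) : ℝ) : ℂ) := by
    push_cast
    ring
  rw [e]
  refine (norm_sub_le _ _).trans ((add_le_add_left (norm_add_le _ _) _).trans ?_)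
  rw [norm_mul, norm_mul, Complex.norm_real, Complex.norm_real, Complex.norm_real,
    Real.norm_of_nonneg h0, Real.norm_of_nonneg hq, Real.norm_eq_abs]
  have c1 := mul_le_mul_of_nonneg_left b1 hq
  have c2 := mul_le_mul_of_nonneg_left b2 h0
  linarith

lemma norm_centredChar_sub_le {p : ι → ℝ} (h0 : ∀ i, 0 ≤ p i) (h1 : ∀ i, p i ≤ 1) {t : ℝ}
    (ht : |t| ≤ 1) :
    ‖centredChar p t - Complex.exp (-((var p * t ^ 2 : ℝ) : ℂ) / 2)‖ ≤
      var p * (|t| ^ 3 + t ^ 4) := by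
  have e : Complex.exp (-((var p * t ^ 2 : ℝ) : ℂ) / 2) =
      ∏ i, ((Real.exp (-(p i * (1 - p i) * t ^ 2 / 2)) : ℝ) : ℂ) := by
    rw [← Complex.ofReal_prod, ← Real.exp_sum, Complex.ofReal_exp, Finset.sum_neg_distrib,
      ← Finset.sum_div, ← Finset.sum_mul, var]
    push_cast
    ring_nf
  rw [e, centredChar]
  refine (norm_prod_sub_prod_le _ _ _ (fun i _ => norm_factor_le_one (h0 i) (h1 i) t)
    fun i _ => ?_).trans ?_
  · rw [Complex.norm_real, Real.norm_of_nonneg (Real.exp_pos _).le, Real.exp_le_one_iff]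
    have := mul_nonneg (h0 i) (sub_nonneg.2 (h1 i))
    have := mul_nonneg this (sq_nonneg t)
    linarith
  · rw [var, Finset.sum_mul]
    exact Finset.sum_le_sum fun i _ => norm_factor_sub_le (h0 i) (h1 i) ht

lemma tendsto_truncChar {κ : ℕ → Type*} [∀ n, Fintype (κ n)] {p : ∀ n, κ n → ℝ}
    (h0 : ∀ n i, 0 ≤ p n i) (h1 : ∀ n i, p n i ≤ 1) {σ : ℕ → ℝ} (hv : ∀ n, σ n ^ 2 = var (p n))
    (hσ : Tendsto σ atTop atTop) (s : ℝ) :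
    Tendsto (fun n => truncChar (p n) (σ n) s) atTop (nhds (Complex.exp (-(s : ℂ) ^ 2 / 2))) := by
  rw [tendsto_iff_norm_sub_tendsto_zero]
  have hlim : Tendsto (fun n => |s| ^ 3 / σ n + s ^ 4 / σ n ^ 2) atTop (nhds 0) := by
    simpa using (tendsto_const_nhds.div_atTop hσ).add
      (tendsto_const_nhds.div_atTop ((tendsto_pow_atTop two_ne_zero).comp hσ))
  refine squeeze_zero' (Eventually.of_forall fun _ => norm_nonneg _) ?_ hlim
  filter_upwards [hσ.eventually_gt_atTop 0, hσ.eventually_gt_atTop |s|] with n hpos hs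
  have ht : |s / σ n| ≤ 1 := by
    rw [abs_div, abs_of_pos hpos, div_le_one hpos]
    exact hs.le
  have hmem : s ∈ Set.Ioc (-(Real.pi * σ n)) (Real.pi * σ n) := by
    have h3 : σ n ≤ Real.pi * σ n := le_mul_of_one_le_left hpos.le (by linarith [Real.pi_gt_three])
    have := abs_lt.1 hs
    constructor <;> linarith
  have h := norm_centredChar_sub_le (h0 n) (h1 n) ht
  rw [truncChar, Set.indicator_of_mem hmem]
  convert h using 1
  · rw [← hv, ← mul_pow, mul_div_cancel₀ _ hpos.ne']
    push_cast
    rfl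
  · rw [← hv, abs_div, abs_of_pos hpos]
    field_simp

lemma tendsto_charError {κ : ℕ → Type*} [∀ n, Fintype (κ n)] {p : ∀ n, κ n → ℝ}
    (h0 : ∀ n i, 0 ≤ p n i) (h1 : ∀ n i, p n i ≤ 1) {σ : ℕ → ℝ} (hv : ∀ n, σ n ^ 2 = var (p n))
    (hσ : Tendsto σ atTop atTop) :
    Tendsto (fun n => charError (p n) (σ n)) atTop (nhds 0) := by
  have hg := integrable_cexp_neg_sq_div_two
  have h := MeasureTheory.tendsto_integral_filter_of_dominated_convergence (l := atTop)
    (μ := MeasureTheory.volume)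
    (F := fun n (s : ℝ) => ‖truncChar (p n) (σ n) s - Complex.exp (-(s : ℂ) ^ 2 / 2)‖)
    (f := fun _ => (0 : ℝ))
    (fun s => Real.exp (-(2 / Real.pi ^ 2) * s ^ 2) + ‖Complex.exp (-(s : ℂ) ^ 2 / 2)‖)
    (Eventually.of_forall fun n => ((integrable_truncChar _ _).sub hg).norm.aestronglyMeasurable)
    (by
      filter_upwards [hσ.eventually_gt_atTop 0] with n hpos
      refine MeasureTheory.ae_of_all _ fun s => ?_
      rw [norm_norm]
      exact (norm_sub_le _ _).trans
        (add_le_add_left (norm_truncChar_le (h0 n) (h1 n) hpos (hv n) s) _))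
    ((integrable_exp_neg_mul_sq (by positivity)).add hg.norm)
    (MeasureTheory.ae_of_all _ fun s =>
      tendsto_iff_norm_sub_tendsto_zero.1 (tendsto_truncChar h0 h1 hv hσ s))
  simpa [charError] using h.const_mul (2 * Real.pi)⁻¹

lemma gauss_nonneg (x : ℝ) : 0 ≤ gauss x := by
  unfold gauss
  positivity

lemma inv_sqrt_two_pi_le_one : (Real.sqrt (2 * Real.pi))⁻¹ ≤ 1 :=
  inv_le_one_of_one_le₀ (Real.one_le_sqrt.2 (by linarith [Real.pi_gt_three]))

lemma gauss_le_one (x : ℝ) : gauss x ≤ 1 := by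
  refine mul_le_one₀ inv_sqrt_two_pi_le_one (Real.exp_pos _).le (Real.exp_le_one_iff.2 ?_)
  have := sq_nonneg x
  linarith

lemma abs_gauss_sub_gauss_le (x y : ℝ) : |gauss x - gauss y| ≤ |x - y| := by
  have hd : ∀ x, HasDerivAt gauss
      ((Real.sqrt (2 * Real.pi))⁻¹ * (Real.exp (-x ^ 2 / 2) * (-(2 * x) / 2))) x := by
    intro x
    have h := ((((hasDerivAt_id x).pow 2).neg.div_const 2).exp).const_mul
      (Real.sqrt (2 * Real.pi))⁻¹
    exact h.congr_deriv (by simp)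
  have hl : LipschitzWith 1 gauss := by
    refine lipschitzWith_of_nnnorm_deriv_le (fun x => (hd x).differentiableAt) fun x => ?_
    rw [(hd x).deriv, ← NNReal.coe_le_coe, coe_nnnorm, NNReal.coe_one, Real.norm_eq_abs, abs_mul,
      abs_of_nonneg (by positivity)]
    refine mul_le_one₀ inv_sqrt_two_pi_le_one (abs_nonneg _) ?_
    rw [abs_mul, abs_of_pos (Real.exp_pos _), neg_div, Real.exp_neg,
      inv_mul_le_one₀ (Real.exp_pos _)]
    refine le_trans ?_ (Real.add_one_le_exp _)
    rw [abs_le]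
    constructor <;> nlinarith [sq_nonneg (x - 1), sq_nonneg (x + 1)]
  simpa [Real.dist_eq] using hl.dist_le_mul x y

lemma integrable_gauss : MeasureTheory.Integrable gauss := by
  have h := (integrable_exp_neg_mul_sq (b := 1 / 2) (by norm_num)).const_mul
    (Real.sqrt (2 * Real.pi))⁻¹
  convert h using 3
  unfold gauss
  ring_nf

lemma integral_gauss : ∫ x, gauss x = 1 := by
  have h := integral_gaussian (1 / 2)
  unfold gauss
  rw [MeasureTheory.integral_const_mul]
  have e : (fun x : ℝ => Real.exp (-x ^ 2 / 2)) = fun x => Real.exp (-(1 / 2) * x ^ 2) := by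
    ext x
    ring_nf
  rw [e, h, show Real.pi / (1 / 2) = 2 * Real.pi by ring]
  exact inv_mul_cancel₀ (by positivity)

/-- The density of the standardised sum after smoothing each atom over a unit interval. -/
noncomputable def stepDensity (p : ι → ℝ) (σ x : ℝ) : ℝ := σ * mass p ⌊∑ i, p i + x * σ⌋

lemma abs_stepDensity_sub_gauss_le (p : ι → ℝ) {σ : ℝ} (hσ : 0 < σ) (x : ℝ) :
    |stepDensity p σ x - gauss x| ≤ charError p σ + 1 / σ := by
  refine (abs_sub_le _ (gauss ((⌊∑ i, p i + x * σ⌋ - ∑ i, p i) / σ)) _).trans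
    (add_le_add (abs_mass_sub_gauss_le p hσ _) ((abs_gauss_sub_gauss_le _ _).trans ?_))
  have h1 := Int.floor_le (∑ i, p i + x * σ)
  have h2 := Int.lt_floor_add_one (∑ i, p i + x * σ)
  rw [div_sub' hσ.ne', abs_div, abs_of_pos hσ, div_le_div_iff_of_pos_right hσ, abs_le]
  constructor <;> linarith

lemma genPoly_coeff_nonneg {p : ι → ℝ} (h0 : ∀ i, 0 ≤ p i) (h1 : ∀ i, p i ≤ 1) (k : ℕ) :
    0 ≤ (genPoly p).coeff k := by
  have h : ∀ s : Finset ι, ∀ k, 0 ≤ (∏ i ∈ s, (C (1 - p i) + C (p i) * X)).coeff k := by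
    intro s
    induction s using Finset.induction_on with
    | empty =>
      intro k
      rw [Finset.prod_empty, coeff_one]
      split_ifs <;> norm_num
    | insert j s hj ih =>
      intro k
      rw [Finset.prod_insert hj, add_mul, coeff_add, coeff_C_mul, mul_assoc, coeff_C_mul]
      refine add_nonneg (mul_nonneg (sub_nonneg.2 (h1 j)) (ih k)) (mul_nonneg (h0 j) ?_)
      cases k with
      | zero => simp
      | succ k => simpa [coeff_X_mul] using ih k
  exact h _ k

lemma mass_nonneg {p : ι → ℝ} (h0 : ∀ i, 0 ≤ p i) (h1 : ∀ i, p i ≤ 1) (m : ℤ) : 0 ≤ mass p m := by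
  rw [mass]
  split_ifs
  · exact genPoly_coeff_nonneg h0 h1 _
  · exact le_rfl

lemma sum_genPoly_coeff (p : ι → ℝ) :
    ∑ k ∈ range (Fintype.card ι + 1), (genPoly p).coeff k = 1 := by
  have h := Polynomial.eval_eq_sum_range' (genPoly_natDegree_lt p) 1
  simp only [one_pow, mul_one] at h
  rw [← h, genPoly, eval_prod]
  simp

/-- The points whose rescaling lies in `[k, k + 1)`. -/
lemma floor_eq_iff_mem_Ico {σ : ℝ} (hσ : 0 < σ) (μ x : ℝ) (k : ℕ) :
    (k : ℤ) = ⌊μ + x * σ⌋ ↔ x ∈ Set.Ico ((k - μ) / σ) ((k + 1 - μ) / σ) := by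
  rw [eq_comm, Int.floor_eq_iff, Set.mem_Ico, div_le_iff₀ hσ, lt_div_iff₀ hσ, Int.cast_natCast]
  constructor <;> rintro ⟨h1, h2⟩ <;> constructor <;> linarith

lemma stepDensity_eq_sum (p : ι → ℝ) {σ : ℝ} (hσ : 0 < σ) :
    stepDensity p σ = fun x => ∑ k ∈ range (Fintype.card ι + 1),
      (Set.Ico ((k - ∑ i, p i) / σ) ((k + 1 - ∑ i, p i) / σ)).indicator
        (fun _ => σ * (genPoly p).coeff k) x := by
  ext x
  rw [stepDensity, mass_eq_sum, Finset.mul_sum]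
  refine Finset.sum_congr rfl fun k _ => ?_
  simp only [floor_eq_iff_mem_Ico hσ, Set.indicator_apply]
  split_ifs <;> simp

lemma integrable_indicator_Ico_const (a b c : ℝ) :
    MeasureTheory.Integrable ((Set.Ico a b).indicator fun _ => c) := by
  rw [MeasureTheory.integrable_indicator_iff measurableSet_Ico]
  exact MeasureTheory.integrableOn_const (by simp)

lemma integrable_stepDensity (p : ι → ℝ) {σ : ℝ} (hσ : 0 < σ) :
    MeasureTheory.Integrable (stepDensity p σ) := by
  rw [stepDensity_eq_sum p hσ]
  exact MeasureTheory.integrable_finsetSum _ fun k _ => integrable_indicator_Ico_const _ _ _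

lemma setIntegral_stepDensity (p : ι → ℝ) {σ : ℝ} (hσ : 0 < σ) {s : Set ℝ} (hs : MeasurableSet s) :
    ∫ x in s, stepDensity p σ x = ∑ k ∈ range (Fintype.card ι + 1), (genPoly p).coeff k *
      (σ * MeasureTheory.volume.real
        (Set.Ico ((k - ∑ i, p i) / σ) ((k + 1 - ∑ i, p i) / σ) ∩ s)) := by
  rw [stepDensity_eq_sum p hσ, MeasureTheory.integral_finsetSum _
    fun k _ => (integrable_indicator_Ico_const _ _ _).integrableOn]
  refine Finset.sum_congr rfl fun k _ => ?_
  rw [MeasureTheory.integral_indicator measurableSet_Ico, MeasureTheory.setIntegral_const,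
    MeasureTheory.measureReal_restrict_apply' hs, smul_eq_mul]
  ring

lemma integral_stepDensity (p : ι → ℝ) {σ : ℝ} (hσ : 0 < σ) : ∫ x, stepDensity p σ x = 1 := by
  rw [← MeasureTheory.setIntegral_univ, setIntegral_stepDensity p hσ MeasurableSet.univ]
  refine Eq.trans ?_ (sum_genPoly_coeff p)
  refine Finset.sum_congr rfl fun k _ => ?_
  rw [Set.inter_univ, Real.volume_real_Ico_of_le (by gcongr; linarith)]
  field_simp
  ring

lemma mass_le (p : ι → ℝ) {σ : ℝ} (hσ : 0 < σ) (m : ℤ) :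
    mass p m ≤ (charError p σ + 1) / σ := by
  rw [le_div_iff₀ hσ, mul_comm]
  have h := (abs_le.1 (abs_mass_sub_gauss_le p hσ m)).2
  have := gauss_le_one ((m - ∑ i, p i) / σ)
  linarith

lemma abs_sum_sub_integral_stepDensity_le {p : ι → ℝ} (h0 : ∀ i, 0 ≤ p i) (h1 : ∀ i, p i ≤ 1)
    {σ : ℝ} (hσ : 0 < σ) (x : ℝ) :
    |(∑ k ∈ range (Fintype.card ι + 1),
        if (k : ℝ) ≤ ∑ i, p i + x * σ then (genPoly p).coeff k else 0) -
      ∫ y in Set.Iic x, stepDensity p σ y| ≤ mass p ⌊∑ i, p i + x * σ⌋ := by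
  set μ := ∑ i, p i with hμ
  rw [setIntegral_stepDensity p hσ measurableSet_Iic, ← Finset.sum_sub_distrib, mass_eq_sum, ← hμ]
  refine (Finset.abs_sum_le_sum_abs _ _).trans (Finset.sum_le_sum fun k _ => ?_)
  have hc := genPoly_coeff_nonneg h0 h1 k
  have hlen : σ * MeasureTheory.volume.real (Set.Ico ((k - μ) / σ) ((k + 1 - μ) / σ)) = 1 := by
    rw [Real.volume_real_Ico_of_le (by gcongr; linarith)]
    field_simp
    ring
  have hle : σ * MeasureTheory.volume.real
      (Set.Ico ((k - μ) / σ) ((k + 1 - μ) / σ) ∩ Set.Iic x) ≤ 1 := by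
    refine le_trans ?_ hlen.le
    exact mul_le_mul_of_nonneg_left
      (MeasureTheory.measureReal_mono Set.inter_subset_left (by simp)) hσ.le
  have hge : 0 ≤ σ * MeasureTheory.volume.real
      (Set.Ico ((k - μ) / σ) ((k + 1 - μ) / σ) ∩ Set.Iic x) := by positivity
  rcases lt_or_ge (μ + x * σ) k with hlt | hkle
  · have hempty : Set.Ico ((k - μ) / σ) ((k + 1 - μ) / σ) ∩ Set.Iic x = ∅ := by
      refine Set.eq_empty_of_forall_notMem fun y hy => ?_
      have h2 := (div_le_iff₀ hσ).1 hy.1.1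
      have h3 := mul_le_mul_of_nonneg_right (show y ≤ x from hy.2) hσ.le
      linarith
    rw [if_neg (not_le.2 hlt), hempty]
    simp only [MeasureTheory.measureReal_empty, mul_zero, sub_zero, abs_zero]
    positivity
  · rw [if_pos hkle]
    split_ifs with hfl
    · rw [mul_one, ← mul_one_sub, abs_of_nonneg (mul_nonneg hc (by linarith))]
      exact mul_le_of_le_one_right hc (by linarith)
    · have hsub : Set.Ico ((k - μ) / σ) ((k + 1 - μ) / σ) ∩ Set.Iic x =
          Set.Ico ((k - μ) / σ) ((k + 1 - μ) / σ) := by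
        refine Set.inter_eq_left.2 fun y hy => ?_
        have hk : (k + 1 - μ) / σ ≤ x := by
          by_contra! hx
          refine hfl ((floor_eq_iff_mem_Ico hσ μ x k).2 ⟨?_, hx⟩)
          rw [div_le_iff₀ hσ]
          linarith
        exact hy.2.le.trans hk
      rw [hsub, hlen]
      simp

lemma abs_sum_sub_integral_gauss_le {p : ι → ℝ} (h0 : ∀ i, 0 ≤ p i) (h1 : ∀ i, p i ≤ 1)
    {σ : ℝ} (hσ : 0 < σ) (x : ℝ) :
    |(∑ k ∈ range (Fintype.card ι + 1),
        if (k : ℝ) ≤ ∑ i, p i + x * σ then (genPoly p).coeff k else 0) -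
      ∫ y in Set.Iic x, gauss y| ≤
      (charError p σ + 1) / σ + ∫ y, |stepDensity p σ y - gauss y| := by
  have hi := integrable_stepDensity p hσ
  refine (abs_sub_le _ (∫ y in Set.Iic x, stepDensity p σ y) _).trans (add_le_add
    ((abs_sum_sub_integral_stepDensity_le h0 h1 hσ x).trans (mass_le p hσ _)) ?_)
  rw [← MeasureTheory.integral_sub hi.integrableOn integrable_gauss.integrableOn]
  refine (MeasureTheory.abs_integral_le_integral_abs).trans ?_
  exact MeasureTheory.setIntegral_le_integral (hi.sub integrable_gauss).abs
    (MeasureTheory.ae_of_all _ fun _ => abs_nonneg _)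

section Limit

variable {κ : ℕ → Type*} [∀ n, Fintype (κ n)] {p : ∀ n, κ n → ℝ} {σ : ℕ → ℝ}

/-- Convergence of the smoothed densities in `L¹`, by Scheffé's argument. -/
lemma tendsto_integral_abs_stepDensity_sub_gauss
    (h0 : ∀ n i, 0 ≤ p n i) (h1 : ∀ n i, p n i ≤ 1) (hv : ∀ n, σ n ^ 2 = var (p n))
    (hσ : Tendsto σ atTop atTop) :
    Tendsto (fun n => ∫ y, |stepDensity (p n) (σ n) y - gauss y|) atTop (nhds 0) := by
  have herr : Tendsto (fun n => charError (p n) (σ n) + 1 / σ n) atTop (nhds 0) := by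
    simpa using (tendsto_charError h0 h1 hv hσ).add ((tendsto_const_nhds (x := (1 : ℝ))).div_atTop hσ)
  have hpt : ∀ y, Tendsto (fun n => max (gauss y - stepDensity (p n) (σ n) y) 0)
      atTop (nhds 0) := by
    intro y
    refine squeeze_zero' (Eventually.of_forall fun _ => le_max_right _ _) ?_ herr
    filter_upwards [hσ.eventually_gt_atTop 0] with n hpos
    have h := abs_stepDensity_sub_gauss_le (p n) hpos y
    exact max_le (by linarith [(abs_le.1 h).1]) ((abs_nonneg _).trans h)
  have hlim := MeasureTheory.tendsto_integral_filter_of_dominated_convergence (l := atTop)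
    (μ := MeasureTheory.volume)
    (F := fun n y => max (gauss y - stepDensity (p n) (σ n) y) 0) (f := fun _ => (0 : ℝ))
    gauss
    (by
      filter_upwards [hσ.eventually_gt_atTop 0] with n hpos
      exact (integrable_gauss.sub (integrable_stepDensity (p n) hpos)).pos_part.aestronglyMeasurable)
    (by
      filter_upwards [hσ.eventually_gt_atTop 0] with n hpos
      refine MeasureTheory.ae_of_all _ fun y => ?_
      rw [Real.norm_of_nonneg (le_max_right _ _)]
      exact max_le (sub_le_self _ (mul_nonneg hpos.le (mass_nonneg (h0 n) (h1 n) _)))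
        (gauss_nonneg y))
    integrable_gauss
    (MeasureTheory.ae_of_all _ hpt)
  have hlim2 := hlim.const_mul 2
  rw [MeasureTheory.integral_zero, mul_zero] at hlim2
  refine hlim2.congr' ?_
  filter_upwards [hσ.eventually_gt_atTop 0] with n hpos
  have hi := integrable_stepDensity (p n) hpos
  have e : ∀ y, |stepDensity (p n) (σ n) y - gauss y| =
      (stepDensity (p n) (σ n) y - gauss y) +
        2 * max (gauss y - stepDensity (p n) (σ n) y) 0 := by
    intro y
    rcases le_total (stepDensity (p n) (σ n) y) (gauss y) with h | h
    · rw [abs_of_nonpos (by linarith), max_eq_left (by linarith)]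
      ring
    · rw [abs_of_nonneg (by linarith), max_eq_right (by linarith)]
      ring
  have i1 : MeasureTheory.Integrable fun y => stepDensity (p n) (σ n) y - gauss y :=
    hi.sub integrable_gauss
  have i2 : MeasureTheory.Integrable fun y => 2 * max (gauss y - stepDensity (p n) (σ n) y) 0 :=
    (integrable_gauss.sub hi).pos_part.const_mul 2
  simp_rw [e]
  rw [MeasureTheory.integral_add i1 i2,
    MeasureTheory.integral_sub hi integrable_gauss, integral_stepDensity _ hpos, integral_gauss,
    MeasureTheory.integral_const_mul]
  ring

lemma tendsto_iSup_abs_of_le {f : ℕ → ℝ → ℝ} {b : ℕ → ℝ} (hb : Tendsto b atTop (nhds 0))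
    (h : ∀ᶠ n in atTop, ∀ x, |f n x| ≤ b n) :
    Tendsto (fun n => ⨆ x, |f n x|) atTop (nhds 0) :=
  squeeze_zero' (Eventually.of_forall fun _ => Real.iSup_nonneg fun _ => abs_nonneg _)
    (h.mono fun _ hn => ciSup_le hn) hb

/-- The central limit theorem for sums of independent Bernoulli variables. -/
theorem central_limit
    (h0 : ∀ n i, 0 ≤ p n i) (h1 : ∀ n i, p n i ≤ 1) (hv : ∀ n, σ n ^ 2 = var (p n))
    (hσ : Tendsto σ atTop atTop) :
    Tendsto (fun n => ⨆ x : ℝ, |(∑ k ∈ range (Fintype.card (κ n) + 1),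
        if (k : ℝ) ≤ ∑ i, p n i + x * σ n then (genPoly (p n)).coeff k else 0) -
      ∫ y in Set.Iic x, gauss y|) atTop (nhds 0) := by
  have hb : Tendsto (fun n => (charError (p n) (σ n) + 1) / σ n +
      ∫ y, |stepDensity (p n) (σ n) y - gauss y|) atTop (nhds 0) := by
    simpa using (((tendsto_charError h0 h1 hv hσ).add_const 1).div_atTop hσ).add
      (tendsto_integral_abs_stepDensity_sub_gauss h0 h1 hv hσ)
  refine tendsto_iSup_abs_of_le hb ?_
  filter_upwards [hσ.eventually_gt_atTop 0] with n hpos x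
  exact abs_sum_sub_integral_gauss_le (h0 n) (h1 n) hpos x

/-- The local limit theorem for sums of independent Bernoulli variables. -/
theorem local_limit
    (h0 : ∀ n i, 0 ≤ p n i) (h1 : ∀ n i, p n i ≤ 1) (hv : ∀ n, σ n ^ 2 = var (p n))
    (hσ : Tendsto σ atTop atTop) :
    Tendsto (fun n => ⨆ x : ℝ, |σ n * mass (p n) ⌊∑ i, p n i + x * σ n⌋ - gauss x|)
      atTop (nhds 0) := by
  have hb : Tendsto (fun n => charError (p n) (σ n) + 1 / σ n) atTop (nhds 0) := by
    simpa using (tendsto_charError h0 h1 hv hσ).add ((tendsto_const_nhds (x := (1 : ℝ))).div_atTop hσ)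
  refine tendsto_iSup_abs_of_le hb ?_
  filter_upwards [hσ.eventually_gt_atTop 0] with n hpos x
  exact abs_stepDensity_sub_gauss_le (p n) hpos x

end Limit

end PoissonBinomial

lemma lapMatrix_root_mem {V : Type*} [Fintype V] [DecidableEq V] (G : SimpleGraph V)
    [DecidableRel G.Adj] {x : ℝ} (hx : (G.lapMatrix ℝ).charpoly.IsRoot x) :
    0 ≤ x ∧ x ≤ 2 * G.maxDegree := by
  rw [← Matrix.charpoly_toLin', ← Module.End.hasEigenvalue_iff_isRoot_charpoly] at hx
  obtain ⟨v, hv⟩ := eigenvalue_mem_ball hx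
  have hdiag : G.lapMatrix ℝ v v = G.degree v := by
    simp [SimpleGraph.lapMatrix, SimpleGraph.degMatrix]
  have hoff : ∑ w ∈ univ.erase v, ‖G.lapMatrix ℝ v w‖ = G.degree v := by
    have h : ∀ w ∈ univ.erase v, ‖G.lapMatrix ℝ v w‖ = G.adjMatrix ℝ v w := by
      intro w hw
      rw [SimpleGraph.lapMatrix, SimpleGraph.degMatrix, Matrix.sub_apply,
        Matrix.diagonal_apply_ne _ (Finset.ne_of_mem_erase hw).symm, zero_sub, norm_neg,
        SimpleGraph.adjMatrix_apply]
      split_ifs <;> simp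
    rw [Finset.sum_congr rfl h, Finset.sum_erase _ (by simp)]
    simp [SimpleGraph.adjMatrix_apply, ← SimpleGraph.card_neighborFinset_eq_degree,
      SimpleGraph.neighborFinset_eq_filter]
  rw [hdiag, hoff, Metric.mem_closedBall, Real.dist_eq, abs_le] at hv
  have hd : (G.degree v : ℝ) ≤ G.maxDegree := by exact_mod_cast G.degree_le_maxDegree v
  constructor <;> linarith

lemma sum_lapMatrix_roots {V ι : Type*} [Fintype V] [DecidableEq V] [Fintype ι]
    (G : SimpleGraph V) [DecidableRel G.Adj] {lam : ι → ℝ}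
    (h : (G.lapMatrix ℝ).charpoly = ∏ i, (X - C (lam i))) :
    ∑ i, lam i = 2 * G.edgeFinset.card := by
  have hs : (G.lapMatrix ℝ).charpoly.Splits := by
    rw [h]
    exact Splits.prod fun i _ => Splits.X_sub_C _
  have ht := Matrix.trace_eq_sum_roots_charpoly_of_splits hs
  have hr : (∏ i, (X - C (lam i))).roots = univ.val.map lam := by
    rw [← Polynomial.roots_multiset_prod_X_sub_C (univ.val.map lam), Multiset.map_map]
    rfl
  rw [h, hr] at ht
  rw [Finset.sum, ← ht]
  have hd : (∑ v, (G.degree v : ℝ)) = 2 * G.edgeFinset.card := by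
    exact_mod_cast G.sum_degrees_eq_twice_card_edges
  rw [← hd]
  simp [Matrix.trace, SimpleGraph.lapMatrix, SimpleGraph.degMatrix]

lemma neg_one_pow_mul_coeff_prod_X_sub_C {ι : Type*} [Fintype ι] (lam : ι → ℝ) (k : ℕ) :
    (-1 : ℝ) ^ (Fintype.card ι - k) * (∏ i, (X - C (lam i))).coeff k =
      (∏ i, (X + C (lam i))).coeff k := by
  have e : ∏ i, (X + C (lam i)) =
      C ((-1 : ℝ) ^ Fintype.card ι) * (∏ i, (X - C (lam i))).comp (C (-1) * X) := by
    rw [Polynomial.prod_comp, map_pow, ← Finset.card_univ, ← Finset.prod_const,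
      ← Finset.prod_mul_distrib]
    refine Finset.prod_congr rfl fun i _ => ?_
    simp
    ring
  rw [e, coeff_C_mul, comp_C_mul_X_coeff]
  rcases le_or_gt k (Fintype.card ι) with hk | hk
  · obtain ⟨m, hm⟩ := Nat.exists_eq_add_of_le hk
    rw [hm, Nat.add_sub_cancel_left, pow_add]
    have : (-1 : ℝ) ^ k * (-1) ^ k = 1 := by rw [← mul_pow]; norm_num
    linear_combination -(-1 : ℝ) ^ m * (∏ i, (X - C (lam i))).coeff k * this
  · rw [coeff_eq_zero_of_natDegree_lt]
    · simp
    · refine ((natDegree_prod_le _ _).trans ?_).trans_lt hk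
      simp

lemma coeff_prod_X_add_C_div {ι : Type*} [Fintype ι] {lam : ι → ℝ} (h0 : ∀ i, 0 ≤ lam i) (k : ℕ) :
    (∏ i, (X + C (lam i))).coeff k / ∏ i, (1 + lam i) =
      (PoissonBinomial.genPoly fun i => 1 / (1 + lam i)).coeff k := by
  have e : PoissonBinomial.genPoly (fun i => 1 / (1 + lam i)) =
      C (∏ i, (1 + lam i))⁻¹ * ∏ i, (X + C (lam i)) := by
    rw [PoissonBinomial.genPoly, ← Finset.prod_inv_distrib, map_prod, ← Finset.prod_mul_distrib]
    refine Finset.prod_congr rfl fun i _ => ?_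
    have : 1 + lam i ≠ 0 := by linarith [h0 i]
    rw [mul_add, ← C_mul, add_comm, one_div]
    congr 2
    field_simp
    ring
  rw [e, coeff_C_mul]
  ring

lemma sum_coeff_prod_X_add_C_s2 {ι : Type*} [Fintype ι] (lam : ι → ℝ) :
    ∑ k ∈ range (Fintype.card ι + 1), (∏ i, (X + C (lam i))).coeff k = ∏ i, (1 + lam i) := by
  have hd : (∏ i, (X + C (lam i))).natDegree < Fintype.card ι + 1 := by
    refine Nat.lt_succ_of_le ((natDegree_prod_le _ _).trans ?_)
    simp
  have h := Polynomial.eval_eq_sum_range' hd 1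
  simp only [one_pow, mul_one] at h
  rw [← h, eval_prod]
  simp

/-- The variance is unbounded: each term is at least `λ / (1 + 2Δ)²` and `∑ λ = 2|E|`. -/
lemma tendsto_sum_lam_div_atTop {κ : ℕ → Type*} [∀ n, Fintype (κ n)] {lam : ∀ n, κ n → ℝ}
    {E D : ℕ → ℕ} (hE : StrictMono E)
    (hD : (fun n => (D n : ℝ) ^ 2) =o[atTop] fun n => (E n : ℝ))
    (h0 : ∀ n i, 0 ≤ lam n i) (h2 : ∀ n i, lam n i ≤ 2 * D n)
    (hsum : ∀ n, ∑ i, lam n i = 2 * E n) :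
    Tendsto (fun n => ∑ i, lam n i / (1 + lam n i) ^ 2) atTop atTop := by
  have hET : Tendsto (fun n => (E n : ℝ)) atTop atTop :=
    tendsto_natCast_atTop_atTop.comp hE.tendsto_atTop
  rw [tendsto_atTop]
  intro b
  set B := max b 1 with hB
  have hBpos : 0 < B := lt_max_of_lt_right one_pos
  filter_upwards [hD.bound (c := 1 / (8 * B)) (by positivity), hET.eventually_ge_atTop (2 * B)]
    with n hn hn2
  rw [Real.norm_of_nonneg (by positivity), Real.norm_of_nonneg (by positivity),
    div_mul_eq_mul_div, one_mul, le_div_iff₀ (by positivity)] at hn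
  have hq : (1 + 2 * (D n : ℝ)) ^ 2 ≤ 2 + 8 * (D n : ℝ) ^ 2 := by
    nlinarith [sq_nonneg (1 - 2 * (D n : ℝ))]
  calc b ≤ B := le_max_left _ _
    _ ≤ 2 * E n / (1 + 2 * (D n : ℝ)) ^ 2 := by
      rw [le_div_iff₀ (by positivity)]
      have := mul_le_mul_of_nonneg_left hq hBpos.le
      linarith
    _ = ∑ i, lam n i / (1 + 2 * (D n : ℝ)) ^ 2 := by rw [← hsum, Finset.sum_div]
    _ ≤ _ := by
      refine Finset.sum_le_sum fun i _ => ?_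
      have := h0 n i
      gcongr
      exact h2 n i

/-- If `|E(G_n)|` increases with `n` and `Δ(G_n)² = o(|E(G_n)|)`, then the
Laplacian coefficients `c(G_n, k)` are asymptotically normal by central and local
limit theorems. -/
theorem laplacian_coeffs_asymptotically_normal
    (V : ℕ → Type) [∀ n, Fintype (V n)] [∀ n, DecidableEq (V n)]
    (G : ∀ n, SimpleGraph (V n)) [∀ n, DecidableRel (G n).Adj]
    (hE : StrictMono fun n => (G n).edgeFinset.card)
    (hΔ : (fun n => ((G n).maxDegree : ℝ) ^ 2) =o[atTop] fun n => ((G n).edgeFinset.card : ℝ))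
    (N : ℕ → ℕ) (hN : ∀ n, N n = Fintype.card (V n))
    (lam : ∀ n, Fin (N n) → ℝ)
    (hlam : ∀ n, ((G n).lapMatrix ℝ).charpoly = ∏ i : Fin (N n), (X - C (lam n i)))
    (c : ℕ → ℕ → ℝ)
    (hc : ∀ n k, c n k = (-1 : ℝ) ^ (N n - k) * ((G n).lapMatrix ℝ).charpoly.coeff k)
    (μ σ : ℕ → ℝ)
    (hμ : ∀ n, μ n = ∑ i : Fin (N n), 1 / (1 + lam n i))
    (hσ : ∀ n, σ n ^ 2 = ∑ i : Fin (N n), lam n i / (1 + lam n i) ^ 2)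
    (hσ0 : ∀ n, 0 ≤ σ n) :
    Tendsto (fun n : ℕ => ⨆ x : ℝ,
      |(∑ k ∈ Finset.range (N n + 1),
          if (k : ℝ) ≤ μ n + x * σ n then c n k / (∑ j ∈ Finset.range (N n + 1), c n j) else 0)
        - (Real.sqrt (2 * Real.pi))⁻¹ * ∫ t in Set.Iic x, Real.exp (-t ^ 2 / 2)|)
      atTop (nhds 0)
    ∧
    Tendsto (fun n : ℕ => ⨆ x : ℝ,
      |σ n * (if 0 ≤ ⌊μ n + x * σ n⌋ then
            c n (⌊μ n + x * σ n⌋).toNat / (∑ j ∈ Finset.range (N n + 1), c n j) else 0)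
        - (Real.sqrt (2 * Real.pi))⁻¹ * Real.exp (-x ^ 2 / 2)|)
      atTop (nhds 0) := by
  obtain rfl : N = fun n => Fintype.card (V n) := funext hN
  have hroot : ∀ n i, 0 ≤ lam n i ∧ lam n i ≤ 2 * (G n).maxDegree := fun n i => by
    refine lapMatrix_root_mem (G n) ?_
    rw [hlam, IsRoot.def, eval_prod]
    exact Finset.prod_eq_zero (mem_univ i) (by simp)
  have h0 : ∀ n i, 0 ≤ lam n i := fun n i => (hroot n i).1
  have hσ2 : Tendsto (fun n => σ n ^ 2) atTop atTop := by
    simp_rw [hσ]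
    exact tendsto_sum_lam_div_atTop hE hΔ h0 (fun n i => (hroot n i).2)
      fun n => sum_lapMatrix_roots (G n) (hlam n)
  have hσT : Tendsto σ atTop atTop := by
    refine (Real.tendsto_sqrt_atTop.comp hσ2).congr fun n => ?_
    exact Real.sqrt_sq (hσ0 n)
  set p : ∀ n, Fin (Fintype.card (V n)) → ℝ := fun n i => 1 / (1 + lam n i) with hp
  have hp0 : ∀ n i, 0 ≤ p n i := fun n i => by
    have := h0 n i
    positivity
  have hp1 : ∀ n i, p n i ≤ 1 := fun n i => by
    have := h0 n i
    rw [hp, div_le_one (by positivity)]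
    linarith
  have hv : ∀ n, σ n ^ 2 = PoissonBinomial.var (p n) := fun n => by
    rw [hσ, PoissonBinomial.var]
    refine Finset.sum_congr rfl fun i _ => ?_
    have : 1 + lam n i ≠ 0 := by linarith [h0 n i]
    simp only [hp]
    field_simp
    ring
  have hcoeff : ∀ n k, c n k / ∑ j ∈ range (Fintype.card (V n) + 1), c n j =
      (PoissonBinomial.genPoly (p n)).coeff k := fun n k => by
    have hc' : ∀ k, c n k = (∏ i, (X + C (lam n i))).coeff k := fun k => by
      rw [hc, hlam, ← neg_one_pow_mul_coeff_prod_X_sub_C, Fintype.card_fin]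
    have hs := sum_coeff_prod_X_add_C_s2 (lam n)
    rw [Fintype.card_fin] at hs
    simp_rw [hc']
    rw [hs, coeff_prod_X_add_C_div (h0 n)]
  have hclt := PoissonBinomial.central_limit hp0 hp1 hv hσT
  have hllt := PoissonBinomial.local_limit hp0 hp1 hv hσT
  simp only [PoissonBinomial.gauss, PoissonBinomial.mass, MeasureTheory.integral_const_mul,
    Fintype.card_fin] at hclt hllt
  simp only [hcoeff, hμ]
  exact ⟨hclt, hllt⟩
end

section
/- As $n\to\infty$, $\frac{1}{n}\sum_{j=0}^{n-1}\frac{4\sin^2\frac{j\pi}{n}}{\left(1+4\sin^2\frac{j\pi}{n}\right)^2}\ \longrightarrow\ \frac{2}{5\sqrt{5}}$. (Here the left-hand side equals $\sigma_n^2/n$, where $\sigma_n^2=\sum_i\frac{\lambda_i}{(1+\lambda_i)^2}$ and $\lambda_j=4\sin^2\frac{j\pi}{n}$, $j=0,\dots,n-1$, are the Laplacian eigenvalues of the cycle $C_n$.) -/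
open Filter Finset Real

/-- Left Riemann sums over `[0, 1]` of a continuous derivative converge to the increment of the
antiderivative. -/
theorem tendsto_riemannSum_of_hasDerivAt {G g : ℝ → ℝ} (hg : Continuous g)
    (hG : ∀ x, HasDerivAt G (g x) x) :
    Tendsto (fun n : ℕ => (1 / (n : ℝ)) * ∑ j ∈ Finset.range n, g (j / n))
      atTop (nhds (G 1 - G 0)) := by
  rw [Metric.tendsto_atTop]
  intro ε hε
  have huc : UniformContinuousOn g (Set.Icc 0 1) :=
    isCompact_Icc.uniformContinuousOn_of_continuous hg.continuousOn
  rw [Metric.uniformContinuousOn_iff] at huc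
  obtain ⟨δ, hδ, h⟩ := huc (ε / 2) (half_pos hε)
  obtain ⟨N, hN⟩ := exists_nat_gt (1 / δ)
  refine ⟨N, fun n hn => ?_⟩
  have hnδ : 1 / δ < n := hN.trans_le (by exact_mod_cast hn)
  have hn0 : (0 : ℝ) < n := (one_div_pos.2 hδ).trans hnδ
  have hstep : 1 / (n : ℝ) < δ := by
    rw [div_lt_iff₀ hδ] at hnδ
    rw [div_lt_iff₀ hn0]
    linarith
  have htel : G 1 - G 0 =
      ∑ j ∈ Finset.range n, (G (((j + 1 : ℕ) : ℝ) / n) - G ((j : ℝ) / n)) := by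
    rw [Finset.sum_range_sub (fun j : ℕ => G ((j : ℝ) / n))]
    simp [hn0.ne']
  have hterm : ∀ j ∈ Finset.range n,
      ‖1 / (n : ℝ) * g (j / n) - (G (((j + 1 : ℕ) : ℝ) / n) - G ((j : ℝ) / n))‖
        ≤ 1 / n * (ε / 2) := by
    intro j hj
    have hjn : ((j + 1 : ℕ) : ℝ) ≤ n := by exact_mod_cast Finset.mem_range.1 hj
    have hsub : ((j + 1 : ℕ) : ℝ) / n - (j : ℝ) / n = 1 / n := by
      push_cast
      ring
    have hpos : 0 < 1 / (n : ℝ) := one_div_pos.2 hn0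
    have hj0 : 0 ≤ (j : ℝ) / n := by positivity
    have hj1 : ((j + 1 : ℕ) : ℝ) / n ≤ 1 := (div_le_one hn0).2 hjn
    obtain ⟨c, ⟨hc1, hc2⟩, hc⟩ := exists_hasDerivAt_eq_slope G g
      (show (j : ℝ) / n < ((j + 1 : ℕ) : ℝ) / n by linarith)
      (fun x _ => (hG x).continuousAt.continuousWithinAt) (fun x _ => hG x)
    rw [hsub, eq_div_iff hpos.ne'] at hc
    rw [← hc, mul_comm (g c), ← mul_sub, norm_mul, Real.norm_of_nonneg hpos.le]
    refine mul_le_mul_of_nonneg_left ?_ hpos.le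
    refine (h _ ⟨hj0, by linarith⟩ c ⟨by linarith, by linarith⟩ ?_).le
    rw [Real.dist_eq, abs_lt]
    constructor <;> linarith
  rw [dist_eq_norm, htel, Finset.mul_sum, ← Finset.sum_sub_distrib]
  refine (norm_sum_le_of_le _ hterm).trans_lt ?_
  rw [Finset.sum_const, Finset.card_range, nsmul_eq_mul, ← mul_assoc, mul_one_div_cancel hn0.ne']
  linarith

/-- An antiderivative on the whole line of `(2 - 2 cos x) / (3 - 2 cos x) ^ 2`. -/
theorem hasDerivAt_cycle_variance_density (x : ℝ) :
    HasDerivAt (fun x => 2 / 5 * (1 / √5 *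
        (x + 2 * arctan ((3 - √5) / 2 * sin x / (1 - (3 - √5) / 2 * cos x)))
        - sin x / (3 - 2 * cos x)))
      ((2 - 2 * cos x) / (3 - 2 * cos x) ^ 2) x := by
  have h5 : √5 ^ 2 = 5 := Real.sq_sqrt (by norm_num)
  have hs0 : 0 < √5 := by positivity
  have hlt : 2 < √5 := by nlinarith
  have hlt3 : √5 < 3 := by nlinarith
  obtain ⟨r, hr⟩ : ∃ r, r = (3 - √5) / 2 := ⟨_, rfl⟩
  have hr2 : r ^ 2 = 3 * r - 1 := by rw [hr]; linear_combination h5 / 4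
  have hs : √5 = 3 - 2 * r := by linarith
  rw [← hr]
  have hcos := cos_le_one x
  have hD : 3 - 2 * cos x ≠ 0 := by linarith
  have hE : 1 - r * cos x ≠ 0 := by nlinarith
  have hr0 : r ≠ 0 := by linarith
  have hsc := sin_sq_add_cos_sq x
  have harg := ((hasDerivAt_sin x).const_mul r).div
    (((hasDerivAt_cos x).const_mul r).const_sub 1) hE
  have hmain := (((((hasDerivAt_id x).add (harg.arctan.const_mul 2)).const_mul (1 / √5)).sub
    ((hasDerivAt_sin x).div (((hasDerivAt_cos x).const_mul 2).const_sub 3) hD))).const_mul (2 / 5)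
  refine hmain.congr_deriv ?_
  have hnorm : (1 - r * cos x) ^ 2 + (r * sin x) ^ 2 = r * (3 - 2 * cos x) := by
    linear_combination r ^ 2 * hsc + hr2
  have harct : 1 / (1 + (r * sin x / (1 - r * cos x)) ^ 2) *
      ((r * cos x * (1 - r * cos x) - r * sin x * -(r * -sin x)) / (1 - r * cos x) ^ 2)
      = (cos x - r) / (3 - 2 * cos x) := by
    have h1 : 1 + (r * sin x / (1 - r * cos x)) ^ 2
        = r * (3 - 2 * cos x) / (1 - r * cos x) ^ 2 := by
      rw [← hnorm]
      field_simp
    rw [h1]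
    field_simp
    linear_combination -r * hsc
  have hpoisson : 1 / √5 * (1 + 2 * ((cos x - r) / (3 - 2 * cos x))) = 1 / (3 - 2 * cos x) := by
    field_simp
    linarith
  simp only [Pi.div_apply, harct, hpoisson]
  field_simp
  linear_combination 2 * hsc

/-- `(1/n) ∑_{j=0}^{n-1} 4sin²(jπ/n)/(1+4sin²(jπ/n))² → 2/(5√5)`
as `n → ∞` (the normalized variance for the Laplacian eigenvalues of the cycle `C_n`). -/
theorem cycle_variance_limit :
    Tendsto (fun n : ℕ => (1 / (n : ℝ)) *
        ∑ j ∈ Finset.range n,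
          4 * sin ((j : ℝ) * π / n) ^ 2 / (1 + 4 * sin ((j : ℝ) * π / n) ^ 2) ^ 2)
      atTop (nhds (2 / (5 * Real.sqrt 5))) := by
  have hderiv : ∀ t : ℝ, HasDerivAt (fun t => (fun x => 2 / 5 * (1 / √5 *
        (x + 2 * arctan ((3 - √5) / 2 * sin x / (1 - (3 - √5) / 2 * cos x)))
        - sin x / (3 - 2 * cos x))) (t * (2 * π)) / (2 * π))
      (4 * sin (t * π) ^ 2 / (1 + 4 * sin (t * π) ^ 2) ^ 2) t := by
    intro t
    have h := ((hasDerivAt_cycle_variance_density (t * (2 * π))).comp t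
      ((hasDerivAt_id t).mul_const (2 * π))).div_const (2 * π)
    refine h.congr_deriv ?_
    have hcos : cos (t * (2 * π)) = 1 - 2 * sin (t * π) ^ 2 := by
      rw [show t * (2 * π) = 2 * (t * π) by ring, cos_two_mul, cos_sq']
      ring
    rw [one_mul, mul_div_cancel_right₀ _ (by positivity), hcos]
    ring
  have hcont : Continuous fun t : ℝ =>
      4 * sin (t * π) ^ 2 / (1 + 4 * sin (t * π) ^ 2) ^ 2 :=
    Continuous.div (by fun_prop) (by fun_prop) fun t => by positivity
  convert tendsto_riemannSum_of_hasDerivAt hcont hderiv using 2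
  · simp only [div_mul_eq_mul_div]
  · simp
    field_simp
end

section
/- For every $n\ge 1$, $\sum_{k=1}^{n}\frac{2k\binom{n}{k}}{(1+2k)^2}\ \ge\ \frac{2n(2^n-1)}{(1+2n)^2}$; consequently this sum, which is the variance $\sigma^2=\sum_i\frac{\lambda_i}{(1+\lambda_i)^2}$ associated to the Laplacian eigenvalues of the hypercube $Q_n$, tends to infinity as $n\to\infty$. -/
open Filter Finset

theorem two_mul_div_one_add_two_mul_sq_le {x y : ℝ} (hx : 1 ≤ x) (hxy : x ≤ y) :
    2 * y / (1 + 2 * y) ^ 2 ≤ 2 * x / (1 + 2 * x) ^ 2 := by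
  have hy : 1 ≤ y := hx.trans hxy
  rw [div_le_div_iff₀ (by positivity) (by positivity)]
  have h : 0 ≤ (y - x) * (4 * (x * y) - 1) :=
    mul_nonneg (by linarith) (by nlinarith)
  nlinarith

theorem sum_Icc_one_choose (n : ℕ) :
    ∑ k ∈ Finset.Icc 1 n, (n.choose k : ℝ) = 2 ^ n - 1 := by
  have h : ∑ k ∈ Finset.range (n + 1), (n.choose k : ℝ) = 2 ^ n := by
    exact_mod_cast Nat.sum_range_choose n
  rw [Finset.range_eq_Ico, Finset.sum_eq_sum_Ico_succ_bot (Nat.succ_pos n)] at h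
  rw [← Finset.Ico_add_one_right_eq_Icc, ← h]
  simp

/-- `∑_{k=1}^n 2k C(n,k)/(1+2k)² ≥ 2n(2ⁿ-1)/(1+2n)²` for all `n ≥ 1`;
consequently this sum (the variance associated to the Laplacian eigenvalues of the
hypercube `Q_n`) tends to infinity. -/
theorem hypercube_variance_lower_bound_and_tendsto_atTop :
    (∀ n : ℕ, 1 ≤ n →
      2 * (n : ℝ) * (2 ^ n - 1) / (1 + 2 * n) ^ 2
        ≤ ∑ k ∈ Finset.Icc 1 n, 2 * (k : ℝ) * (n.choose k) / (1 + 2 * k) ^ 2)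
    ∧ Tendsto (fun n : ℕ => ∑ k ∈ Finset.Icc 1 n, 2 * (k : ℝ) * (n.choose k) / (1 + 2 * k) ^ 2)
        atTop atTop := by
  constructor
  · intro n _
    rw [← sum_Icc_one_choose, mul_div_right_comm (2 * (n : ℝ)), Finset.mul_sum]
    refine Finset.sum_le_sum fun k hk => ?_
    rw [Finset.mem_Icc] at hk
    rw [mul_div_right_comm (2 * (k : ℝ))]
    exact mul_le_mul_of_nonneg_right
      (two_mul_div_one_add_two_mul_sq_le (Nat.one_le_cast.2 hk.1) (Nat.cast_le.2 hk.2))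
      (Nat.cast_nonneg _)
  · have hlin : Tendsto (fun n : ℕ => (2 / 9 : ℝ) * n) atTop atTop :=
      tendsto_natCast_atTop_atTop.const_mul_atTop (by norm_num)
    refine tendsto_atTop_mono' atTop ?_ hlin
    filter_upwards [eventually_ge_atTop 1] with n hn
    calc (2 / 9 : ℝ) * n = 2 * ((1 : ℕ) : ℝ) * (n.choose 1) / (1 + 2 * ((1 : ℕ) : ℝ)) ^ 2 := by
          rw [Nat.choose_one_right]
          norm_num
          ring
      _ ≤ _ := Finset.single_le_sum
          (f := fun k : ℕ => 2 * (k : ℝ) * (n.choose k) / (1 + 2 * k) ^ 2)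
          (fun k _ => by positivity) (Finset.mem_Icc.2 ⟨le_rfl, hn⟩)
end

section
/- For every fixed integer $k\ge 1$, the normalized Laplacian coefficients of the complete bipartite graphs $K_{n,n}$ satisfy $\lim_{n\to\infty}\frac{c(K_{n,n},k)}{\sum_{j}c(K_{n,n},j)}=\frac{e^{-2}\,2^{k-1}}{(k-1)!}$; that is, $k-1$ is asymptotically Poisson distributed with mean and variance $2$. -/
open Filter Finset Polynomial
open scoped Classical

theorem Matrix.charpoly_fromBlocks_self {m R : Type*} [Fintype m] [DecidableEq m] [CommRing R]
    (A B : Matrix m m R) :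
    (Matrix.fromBlocks A B B A).charpoly = (A + B).charpoly * (A - B).charpoly := by
  let U : (Matrix (m ⊕ m) (m ⊕ m) R)ˣ :=
    ⟨Matrix.fromBlocks 1 1 0 1, Matrix.fromBlocks 1 (-1) 0 1,
      by simp [Matrix.fromBlocks_multiply], by simp [Matrix.fromBlocks_multiply]⟩
  have h : U.val * Matrix.fromBlocks A B B A * U.inv = Matrix.fromBlocks (A + B) 0 B (A - B) := by
    simp only [U, Matrix.fromBlocks_multiply, Matrix.one_mul, Matrix.zero_mul, Matrix.mul_one,
      Matrix.mul_zero, Matrix.mul_neg, zero_add, add_zero]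
    congr 1 <;> abel
  rw [← Matrix.charpoly_units_conj U, ← Matrix.charpoly_fromBlocks_zero₁₂ (M₂₁ := B), ← h,
    ← Matrix.coe_units_inv]
  rfl

theorem SimpleGraph.degree_completeBipartiteGraph {V : Type*} [Fintype V] (v : V ⊕ V)
    [Fintype ((completeBipartiteGraph V V).neighborSet v)] :
    (completeBipartiteGraph V V).degree v = Fintype.card V := by
  rw [← SimpleGraph.card_neighborSet_eq_degree, ← Nat.card_eq_fintype_card,
    ← Nat.card_eq_fintype_card]
  rcases v with v | v
  · rw [show (completeBipartiteGraph V V).neighborSet (Sum.inl v) = Set.range Sum.inr by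
      ext (w | w) <;> simp]
    exact Nat.card_range_of_injective Sum.inr_injective
  · rw [show (completeBipartiteGraph V V).neighborSet (Sum.inr v) = Set.range Sum.inl by
      ext (w | w) <;> simp]
    exact Nat.card_range_of_injective Sum.inl_injective

theorem SimpleGraph.lapMatrix_completeBipartiteGraph {V R : Type*} [Fintype V] [DecidableEq V]
    [DecidableEq (V ⊕ V)] [DecidableRel (completeBipartiteGraph V V).Adj] [CommRing R] :
    (completeBipartiteGraph V V).lapMatrix R =
      Matrix.fromBlocks (Matrix.scalar V (Fintype.card V : R)) (-Matrix.vecMulVec 1 1)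
        (-Matrix.vecMulVec 1 1) (Matrix.scalar V (Fintype.card V : R)) := by
  ext (i | i) (j | j) <;>
    simp [SimpleGraph.lapMatrix, SimpleGraph.degMatrix, SimpleGraph.degree_completeBipartiteGraph,
      Matrix.diagonal_apply, -map_natCast]

theorem SimpleGraph.charpoly_lapMatrix_completeBipartiteGraph {V R : Type*} [Fintype V]
    [Nonempty V] [DecidableEq V] [inst : DecidableEq (V ⊕ V)]
    [DecidableRel (completeBipartiteGraph V V).Adj] [CommRing R] :
    ((completeBipartiteGraph V V).lapMatrix R).charpoly =
      X * (X - C (2 * (Fintype.card V : R))) *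
        (X - C (Fintype.card V : R)) ^ (2 * (Fintype.card V - 1)) := by
  obtain rfl : inst = instDecidableEqSum := Subsingleton.elim _ _
  have h (ε : R) :
      (Matrix.scalar V (Fintype.card V : R) + Matrix.vecMulVec (fun _ => ε) 1).charpoly =
        (X - C (Fintype.card V : R) - C (ε * Fintype.card V)) *
          (X - C (Fintype.card V : R)) ^ (Fintype.card V - 1) := by
    have hN : Fintype.card V = Fintype.card V - 1 + 1 :=
      (Nat.sub_add_cancel Fintype.card_pos).symm
    rw [show Matrix.scalar V (Fintype.card V : R) + Matrix.vecMulVec (fun _ => ε) 1 =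
        Matrix.vecMulVec (fun _ => ε) 1 - Matrix.scalar V (-(Fintype.card V : R)) by
      rw [map_neg, sub_neg_eq_add, add_comm], Matrix.charpoly_sub_scalar,
      Matrix.charpoly_vecMulVec, show (fun _ : V => ε) ⬝ᵥ 1 = ε * Fintype.card V by
        simp [dotProduct, mul_comm]]
    generalize ε * (Fintype.card V : R) = a
    generalize (Fintype.card V : R) = b
    rw [hN]
    simp only [sub_comp, pow_comp, X_comp, mul_comp, C_comp, smul_eq_C_mul, C_neg, Nat.add_sub_cancel]
    ring
  rw [SimpleGraph.lapMatrix_completeBipartiteGraph, Matrix.charpoly_fromBlocks_self,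
    sub_neg_eq_add, ← Matrix.neg_vecMulVec, show (-1 : V → R) = fun _ => -1 from rfl, h,
    show Matrix.vecMulVec (1 : V → R) (1 : V → R) = Matrix.vecMulVec (fun _ => 1) 1 from rfl, h]
  simp only [neg_mul, one_mul, C_neg, C_mul, C_ofNat]
  ring

/-- The polynomial `∑ₖ c(G, k) xᵏ` of Laplacian coefficients of `K_{n,n}`. -/
theorem SimpleGraph.charpoly_lapMatrix_completeBipartiteGraph_comp_neg_X (s : ℕ)
    [DecidableEq (Fin (s + 1) ⊕ Fin (s + 1))]
    [DecidableRel (completeBipartiteGraph (Fin (s + 1)) (Fin (s + 1))).Adj] :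
    (((completeBipartiteGraph (Fin (s + 1)) (Fin (s + 1))).lapMatrix ℝ).charpoly).comp (-X) =
      X * (X + C (2 * (s + 1 : ℝ))) * (X + C (s + 1 : ℝ)) ^ (2 * s) := by
  rw [SimpleGraph.charpoly_lapMatrix_completeBipartiteGraph]
  simp only [mul_comp, X_comp, sub_comp, C_comp, pow_comp, Fintype.card_fin, Nat.add_sub_cancel,
    Nat.cast_add, Nat.cast_one]
  rw [show (-X - C (s + 1 : ℝ)) ^ (2 * s) = (X + C (s + 1 : ℝ)) ^ (2 * s) by
    rw [pow_mul, pow_mul]; ring]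
  ring

theorem tendsto_binomial_two_div_add_two (m : ℕ) :
    Tendsto (fun s : ℕ => ((2 * s).choose m : ℝ) * (s + 1) ^ (2 * s - m) / (s + 2) ^ (2 * s))
      atTop (nhds (Real.exp (-2) * 2 ^ m / m.factorial)) := by
  have hp : Tendsto (fun N : ℕ => (N : ℝ) * (1 / (N / 2 + 2))) atTop (nhds 2) := by
    have h : Tendsto (fun N : ℕ => (2 : ℝ) - 8 / (N + 4)) atTop (nhds (2 - 0)) :=
      tendsto_const_nhds.sub (tendsto_const_nhds.div_atTop
        (tendsto_atTop_add_const_right _ _ tendsto_natCast_atTop_atTop))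
    rw [sub_zero] at h
    refine h.congr fun N => ?_
    field_simp
    ring
  refine ((ProbabilityTheory.tendsto_choose_mul_pow_of_tendsto_mul_atTop m hp).comp
    (tendsto_id.const_mul_atTop' (two_pos : 0 < 2))).congr fun s => ?_
  simp only [Function.comp_apply, id]
  rcases lt_or_ge (2 * s) m with h | h
  · simp [Nat.choose_eq_zero_of_lt h]
  · obtain ⟨d, hd⟩ := Nat.exists_eq_add_of_le h
    rw [show 2 * s - m = d by omega]
    have h₁ : (1 : ℝ) / (((2 * s : ℕ) : ℝ) / 2 + 2) = 1 / (s + 2) := by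
      push_cast
      congr 1
      ring
    have h₂ : (1 : ℝ) - 1 / (s + 2) = (s + 1) / (s + 2) := by
      field_simp
      ring
    rw [h₁, h₂, div_pow, div_pow, one_pow, hd, pow_add]
    field_simp

/-- for fixed `k ≥ 1`, the normalized Laplacian coefficients of the complete
bipartite graphs `K_{n,n}` satisfy `c(K_{n,n},k)/∑_j c(K_{n,n},j) → e⁻² 2^{k-1}/(k-1)!`,
i.e. they are asymptotically Poisson distributed with mean and variance `2`. -/
theorem complete_bipartite_laplacian_coeffs_poisson
    (k : ℕ) (hk : 1 ≤ k)
    (c : ℕ → ℕ → ℝ)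
    (hc : ∀ n j, c n j = (-1 : ℝ) ^ (2 * n - j) *
      ((completeBipartiteGraph (Fin n) (Fin n)).lapMatrix ℝ).charpoly.coeff j) :
    Tendsto (fun n : ℕ => c n k / ∑ j ∈ Finset.range (2 * n + 1), c n j)
      atTop (nhds (Real.exp (-2) * 2 ^ (k - 1) / (k - 1).factorial)) := by
  obtain ⟨m, rfl⟩ := Nat.exists_eq_add_of_le' hk
  rw [Nat.add_sub_cancel, ← tendsto_add_atTop_iff_nat 1]
  set P : ℕ → ℝ[X] := fun s => X * (X + C (2 * (s + 1 : ℝ))) * (X + C (s + 1 : ℝ)) ^ (2 * s)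
    with hP
  have hdeg (s : ℕ) : (P s).natDegree = 2 * (s + 1) := by
    have h₁ : (X * (X + C (2 * (s + 1 : ℝ)))).Monic := monic_X.mul (monic_X_add_C _)
    have h₂ : ((X + C (s + 1 : ℝ)) ^ (2 * s)).Monic := (monic_X_add_C _).pow _
    rw [hP, h₁.natDegree_mul h₂, monic_X.natDegree_mul (monic_X_add_C _), natDegree_X,
      natDegree_X_add_C, (monic_X_add_C _).natDegree_pow, natDegree_X_add_C]
    ring
  have hcP (s j : ℕ) : c (s + 1) j = (P s).coeff j := by
    rcases le_or_gt j (2 * (s + 1)) with hj | hj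
    · simp only [hc, hP]
      rw [← SimpleGraph.charpoly_lapMatrix_completeBipartiteGraph_comp_neg_X,
        show (-X : ℝ[X]) = C (-1) * X by simp, comp_C_mul_X_coeff, mul_comm]
      exact congrArg _ (neg_one_pow_congr (by simp [Nat.even_sub hj]))
    · rw [coeff_eq_zero_of_natDegree_lt (by rw [hdeg]; exact hj), hc,
        coeff_eq_zero_of_natDegree_lt, mul_zero]
      rw [Matrix.charpoly_natDegree_eq_dim]
      simp
      omega
  have hsum (s : ℕ) : ∑ j ∈ Finset.range (2 * (s + 1) + 1), c (s + 1) j =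
      (2 * s + 3) * (s + 2) ^ (2 * s) := by
    simp_rw [hcP, ← hdeg s]
    have h := (P s).eval_eq_sum_range 1
    simp only [one_pow, mul_one] at h
    rw [← h, hP]
    simp only [eval_mul, eval_pow, eval_add, eval_X, eval_C]
    ring
  have hr₁ : Tendsto (fun s : ℕ => (1 : ℝ) / (2 * s + 3)) atTop (nhds 0) :=
    tendsto_const_nhds.div_atTop (tendsto_atTop_add_const_right _ _
      (tendsto_natCast_atTop_atTop.const_mul_atTop two_pos))
  have hr₂ : Tendsto (fun s : ℕ => (2 * (s + 1) : ℝ) / (2 * s + 3)) atTop (nhds 1) := by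
    have h := (tendsto_const_nhds (x := (1 : ℝ))).sub hr₁
    rw [sub_zero] at h
    refine h.congr fun s => ?_
    field_simp
    ring
  have h₂ := hr₂.mul (tendsto_binomial_two_div_add_two m)
  rw [one_mul] at h₂
  cases m with
  | zero =>
    refine h₂.congr fun s => ?_
    rw [hsum, hcP, hP]
    simp only [mul_assoc, zero_add, coeff_X_mul, add_mul, coeff_add, coeff_X_add_C_pow, mul_add,
      mul_coeff_zero]
    field_simp
    simp
  | succ m =>
    have h := h₂.add (hr₁.mul (tendsto_binomial_two_div_add_two m))
    rw [zero_mul, add_zero] at h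
    refine h.congr fun s => ?_
    rw [hsum, hcP, hP]
    simp only [mul_assoc, coeff_X_mul, add_mul, coeff_add, coeff_C_mul, coeff_X_add_C_pow]
    field_simp
    ring
end
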